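/- arXiv:1002.4911 — 2 statements merged into one kernel-verified Lean document; each statement's English description precedes it below -/
import Mathlib

section
/- Let 1 < q < ∞ and α > 1. There exists a constant C, depending only on α, q and the dimension n, such that for every measurable function f : D → ℂ with ‖f‖_{T^{1,q}(γ)} < ∞ there exist a sequence (λ_n) ∈ ℓ¹ and a sequence (a_n) of T^{1,q}(γ) α-atoms satisfying (i) f = Σ_n λ_n a_n almost everywhere on D, and (ii) Σ_n |λ_n| ≤ C ‖f‖_{T^{1,q}(γ)}. -/
open MeasureTheory Metric Set
open scoped ENNReal

noncomputable section

/-- Euclidean space ℝⁿ. -/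
abbrev E (n : ℕ) := EuclideanSpace ℝ (Fin n)

/-- The standard Gaussian measure on ℝⁿ. -/
def gaussianM (n : ℕ) : Measure (E n) :=
  volume.withDensity
    (fun x => ENNReal.ofReal ((2 * Real.pi) ^ (-(n : ℝ) / 2) * Real.exp (-‖x‖ ^ 2 / 2)))

/-- m(x) = min {1, 1/|x|} (with value 1 at x = 0). -/
def mFun {n : ℕ} (x : E n) : ℝ := if ‖x‖ ≤ 1 then 1 else ‖x‖⁻¹

/-- The measure `dt/t` on `(0,∞)`. -/
def tMeasure : Measure ℝ :=
  (volume.restrict (Set.Ioi (0 : ℝ))).withDensity fun t => ENNReal.ofReal t⁻¹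

/-- The admissible region `D = {(x,t) : 0 < t < m(x)}`. -/
def Dset (n : ℕ) : Set (E n × ℝ) := {p | 0 < p.2 ∧ p.2 < mFun p.1}

/-- The measure `dγ(y) dt/t` on `D`. -/
def DMeasure (n : ℕ) : Measure (E n × ℝ) := ((gaussianM n).prod tMeasure).restrict (Dset n)

/-- The tent with aperture `α` over `A`: `{(y,t) : t > 0, d(y, ∁A) ≥ α t}`. -/
def tentSet (n : ℕ) (α : ℝ) (A : Set (E n)) : Set (E n × ℝ) :=
  {p | 0 < p.2 ∧ α * p.2 ≤ infDist p.1 Aᶜ}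

/-- A `T^{1,q}(γ)` `α`-atom: a measurable function supported in `T_1(B) ∩ D` for some
ball `B ∈ 𝓑_α`, with `‖a‖_{L^q(D, dγ dt/t)} ≤ γ(B)^{-1/q'}` where `1/q' = 1 - 1/q`. -/
def IsTAtom (n : ℕ) (q α : ℝ) (a : E n × ℝ → ℂ) : Prop :=
  Measurable a ∧
  ∃ (c : E n) (r : ℝ), 0 ≤ r ∧ r ≤ α * mFun c ∧
    (∀ p, p ∉ tentSet n 1 (ball c r) ∩ Dset n → a p = 0) ∧
    (∫⁻ p, (‖a p‖₊ : ℝ≥0∞) ^ q ∂(DMeasure n)) ^ (1 / q) ≤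
      gaussianM n (ball c r) ^ (-(1 - 1 / q))

/-- The `T^{1,q}(γ)` (quasi-)norm of a measurable `f : D → ℂ`. -/
def Tnorm (n : ℕ) (q : ℝ) (f : E n × ℝ → ℂ) : ℝ≥0∞ :=
  ∫⁻ x, (∫⁻ p, (ball p.1 p.2).indicator (fun _ => (gaussianM n (ball p.1 p.2))⁻¹) x *
      (‖f p‖₊ : ℝ≥0∞) ^ q ∂(DMeasure n)) ^ (1 / q) ∂(gaussianM n)

/-- dyadic layer-cake sum, pointwise -/
lemma dyadic_sum_le (g : ℝ≥0∞) :
    ∑' k : ℤ, (if ENNReal.ofReal ((2:ℝ)^k) < g then ENNReal.ofReal ((2:ℝ)^k) else 0) ≤ 2 * g := by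
  by_cases hg : g = ⊤
  · simp [hg]
  have hmono : Monotone (fun k : ℤ => (2:ℝ)^(k-1)) := by
    intro a b hab
    exact zpow_le_zpow_right₀ (by norm_num) (by omega)
  have hd := hmono.pairwise_disjoint_on_Ioc_succ
  have hsub : (⋃ k : ℤ, (if ENNReal.ofReal ((2:ℝ)^k) < g then Ioc ((2:ℝ)^(k-1)) ((2:ℝ)^k) else ∅))
      ⊆ Ioc 0 g.toReal := by
    intro x hx
    obtain ⟨k, hk⟩ := mem_iUnion.1 hx
    split_ifs at hk with h
    · refine ⟨lt_trans (by positivity) hk.1, hk.2.trans ?_⟩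
      rw [← ENNReal.ofReal_toReal hg] at h
      exact (ENNReal.ofReal_lt_ofReal_iff_of_nonneg (by positivity)).1 h |>.le
    · exact absurd hk (by simp)
  have hterm : ∀ k : ℤ, (if ENNReal.ofReal ((2:ℝ)^k) < g then ENNReal.ofReal ((2:ℝ)^k) else 0)
      = 2 * volume (if ENNReal.ofReal ((2:ℝ)^k) < g then Ioc ((2:ℝ)^(k-1)) ((2:ℝ)^k) else ∅) := by
    intro k
    split_ifs with h
    · rw [Real.volume_Ioc, ← ENNReal.ofReal_ofNat 2, ← ENNReal.ofReal_mul (by norm_num)]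
      congr 1
      rw [zpow_sub_one₀ (by norm_num)]; ring
    · simp
  calc _ = ∑' k : ℤ, 2 * volume (if ENNReal.ofReal ((2:ℝ)^k) < g then Ioc ((2:ℝ)^(k-1)) ((2:ℝ)^k) else ∅) :=
        tsum_congr hterm
    _ = 2 * ∑' k : ℤ, volume (if ENNReal.ofReal ((2:ℝ)^k) < g then Ioc ((2:ℝ)^(k-1)) ((2:ℝ)^k) else ∅) :=
        ENNReal.tsum_mul_left
    _ = 2 * volume (⋃ k : ℤ, (if ENNReal.ofReal ((2:ℝ)^k) < g then Ioc ((2:ℝ)^(k-1)) ((2:ℝ)^k) else ∅)) := by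
        rw [measure_iUnion]
        · intro a b hab
          have := hd hab
          simp only [Function.onFun, Int.succ_eq_succ, Int.succ, add_sub_cancel_right] at this ⊢
          split_ifs <;> simp [this]
        · intro k; split_ifs <;> simp
    _ ≤ 2 * volume (Ioc 0 g.toReal) := by gcongr
    _ = 2 * g := by simp [Real.volume_Ioc, ENNReal.ofReal_toReal hg]

section abstr
set_option linter.unusedSectionVars false
variable {X Z V : Type*} [MeasurableSpace X] [MeasurableSpace Z] [Countable V] [MeasurableSpace V]
  [DiscreteMeasurableSpace V]

/-- the dyadic cell with index `i` -/
def Qc (cell : ℕ → X → V) (i : ℕ × V) : Set X := {x | cell i.1 x = i.2}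

/-- the kernel of the dyadic square function -/
def ker (γ : Measure X) (cell : ℕ → X → V) (idx : Z → ℕ × V) (x : X) (z : Z) : ℝ≥0∞ :=
  (Qc cell (idx z)).indicator (fun _ => (γ (Qc cell (idx z)))⁻¹) x

lemma meas_Qc {cell : ℕ → X → V} (hcell : ∀ j, Measurable (cell j)) (i : ℕ × V) :
    MeasurableSet (Qc cell i) := hcell i.1 (MeasurableSet.of_discrete (s := {i.2}))

lemma meas_ker (γ : Measure X) {cell : ℕ → X → V} (hcell : ∀ j, Measurable (cell j))
    {idx : Z → ℕ × V} (hidx : Measurable idx) :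
    Measurable (Function.uncurry (ker γ cell idx)) := by
  have h1 : MeasurableSet {w : X × Z | w.1 ∈ Qc cell (idx w.2)} := by
    have : {w : X × Z | w.1 ∈ Qc cell (idx w.2)} = ⋃ i : ℕ × V, (Qc cell i) ×ˢ (idx ⁻¹' {i}) := by
      ext w; simp
    rw [this]
    exact MeasurableSet.iUnion fun i => (meas_Qc hcell i).prod (hidx (MeasurableSet.of_discrete))
  have h2 : Measurable (fun w : X × Z => (γ (Qc cell (idx w.2)))⁻¹) :=
    (Measurable.of_discrete (f := fun i : ℕ × V => (γ (Qc cell i))⁻¹)).comp (hidx.comp measurable_snd)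
  exact h2.indicator h1

theorem abstract_decomp (γ : Measure X) [SFinite γ] (μ : Measure Z) [SFinite μ]
    (cell : ℕ → X → V) (hcell : ∀ j, Measurable (cell j))
    (hnest : ∀ j j' x y, j ≤ j' → cell j' x = cell j' y → cell j x = cell j y)
    (idx : Z → ℕ × V) (hidx : Measurable idx) (base : Z → X) (hbase : Measurable base)
    (hib : ∀ z, (idx z).2 = cell (idx z).1 (base z))
    (D : Set Z) (hD : MeasurableSet D) (hμD : ∀ᵐ z ∂μ, z ∈ D)
    (hpos : ∀ i, γ (Qc cell i) ≠ 0) (hfin : ∀ i, γ (Qc cell i) ≠ ⊤)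
    (F : Z → ℝ≥0∞) (hF : Measurable F) (q : ℝ) (hq : 1 < q)
    (hG : ∫⁻ x, (∫⁻ z, ker γ cell idx x z * F z ∂μ) ^ (1/q) ∂γ ≠ ⊤) :
    ∃ (A : ℤ × ℕ × V → Set Z) (S : Set (ℤ × ℕ × V)), (∀ i, MeasurableSet (A i)) ∧
      (∀ i j z, z ∈ A i → z ∈ A j → i = j) ∧
      (∀ᵐ z ∂μ, F z ≠ 0 → ∃ i, z ∈ A i) ∧
      (∀ i, A i ⊆ D) ∧
      (∀ i, ∀ z ∈ A i, base z ∈ Qc cell i.2 ∧ i.2.1 ≤ (idx z).1) ∧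
      (∀ i, ∀ z ∈ A i, i ∈ S) ∧
      (∀ i ∈ S, ∃ z ∈ D, idx z = i.2) ∧
      (∀ i, ∫⁻ z in A i, F z ∂μ ≤ 2 * (ENNReal.ofReal (2 ^ (i.1 + 1)) ^ q * γ (Qc cell i.2))) ∧
      ∑' i, S.indicator (fun i => ENNReal.ofReal (2 ^ i.1) * γ (Qc cell i.2)) i
        ≤ 4 * ∫⁻ x, (∫⁻ z, ker γ cell idx x z * F z ∂μ) ^ (1/q) ∂γ := by
  classical
  set T : X → ℝ≥0∞ := fun x => ∫⁻ z, ker γ cell idx x z * F z ∂μ with hT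
  have hkm := meas_ker γ hcell hidx
  have hkF : Measurable (Function.uncurry fun x z => ker γ cell idx x z * F z) :=
    hkm.mul (hF.comp measurable_snd)
  have hTm : Measurable T := hkF.lintegral_prod_right
  set G : X → ℝ≥0∞ := fun x => T x ^ (1/q) with hGdef
  have hGm : Measurable G := hTm.pow_const _
  set Ω : ℤ → Set X := fun k => {x | ENNReal.ofReal ((2:ℝ)^k) < G x} with hΩ
  have hΩm : ∀ k, MeasurableSet (Ω k) := fun k => measurableSet_lt measurable_const hGm
  have hΩanti : ∀ k k', k ≤ k' → Ω k' ⊆ Ω k := by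
    intro k k' h x hx
    exact lt_of_le_of_lt (ENNReal.ofReal_le_ofReal (zpow_le_zpow_right₀ (by norm_num) h)) hx
  set Q := Qc cell with hQ
  have hQm : ∀ i, MeasurableSet (Q i) := meas_Qc hcell
  set Good : ℤ → ℕ × V → Prop := fun k i =>
    (∃ z ∈ D, idx z = i) ∧ γ (Q i) / 2 < γ (Q i ∩ Ω k) with hGood
  have hGoodanti : ∀ k k' i, k ≤ k' → Good k' i → Good k i := by
    intro k k' i h hg
    exact ⟨hg.1, hg.2.trans_le (measure_mono (inter_subset_inter_right _ (hΩanti k k' h)))⟩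
  set S : Set (ℤ × ℕ × V) := {i | Good i.1 i.2 ∧
    ∀ x ∈ Q i.2, ∀ j' < i.2.1, ¬ Good i.1 (j', cell j' x)} with hS
  set A : ℤ × ℕ × V → Set Z := fun i =>
    {z | (z ∈ D ∧ Good i.1 (idx z) ∧ ¬ Good (i.1+1) (idx z) ∧ base z ∈ Q i.2) ∧ i ∈ S} with hA
  have hself : ∀ z, base z ∈ Q (idx z) := fun z => (hib z).symm
  have hgen : ∀ i, ∀ z ∈ A i, i.2.1 ≤ (idx z).1 := by
    rintro i z ⟨⟨hz, h1, h2, h3⟩, hi⟩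
    by_contra hlt
    push Not at hlt
    apply hi.2 _ h3 _ hlt
    rw [← hib z]
    exact h1
  refine ⟨A, S, ?_, ?_, ?_, fun i z hz => hz.1.1, fun i z hz => ⟨hz.1.2.2.2, hgen i z hz⟩,
    fun i z hz => hz.2, fun i hi => hi.1.1, ?_, ?_⟩
  · intro i
    have : A i = (D ∩ idx ⁻¹' {u | Good i.1 u ∧ ¬ Good (i.1+1) u} ∩ base ⁻¹' (Q i.2)) ∩ {z | i ∈ S} := by
      ext z
      constructor
      · rintro ⟨⟨a, b, c, d⟩, e⟩; exact ⟨⟨⟨a, b, c⟩, d⟩, e⟩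
      · rintro ⟨⟨⟨a, b, c⟩, d⟩, e⟩; exact ⟨⟨a, b, c, d⟩, e⟩
    rw [this]
    exact ((hD.inter (hidx MeasurableSet.of_discrete)).inter (hbase (hQm _))).inter (.const _)
  · rintro ⟨k, j, v⟩ ⟨k', j', v'⟩ z ⟨⟨hz, h1, h2, h3⟩, hi⟩ ⟨⟨-, h1', h2', h3'⟩, hi'⟩
    have hk : k = k' := by
      rcases lt_trichotomy k k' with h | h | h
      · exact absurd (hGoodanti (k+1) k' _ (by omega) h1') h2
      · exact h
      · exact absurd (hGoodanti (k'+1) k _ (by omega) h1) h2'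
    subst hk
    have hv : cell j (base z) = v := h3
    have hv' : cell j' (base z) = v' := h3'
    rcases lt_trichotomy j j' with h | h | h
    · exact absurd hi.1 (by have := hi'.2 _ h3' j h; rwa [hv] at this)
    · subst h; rw [← hv, ← hv']
    · exact absurd hi'.1 (by have := hi.2 _ h3 j' h; rwa [hv'] at this)
  · -- coverage
    have key : ∀ i : ℕ × V, ∀ᵐ z ∂μ, idx z = i → z ∈ D → F z ≠ 0 → ∃ k, Good k i := by
      intro i
      by_cases hex : ∃ k : ℤ, γ (Q i) / 2 < γ (Q i ∩ Ω k)
      · obtain ⟨k, hk⟩ := hex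
        exact Filter.Eventually.of_forall fun z h1 h2 _ => ⟨k, ⟨z, h2, h1⟩, hk⟩
      push Not at hex
      have : ∃ x ∈ Q i, T x = 0 := by
        by_contra hno
        push Not at hno
        have hU : Q i = ⋃ m : ℕ, (Q i ∩ Ω (-(m:ℤ))) := by
          rw [← inter_iUnion, eq_comm, inter_eq_left]
          intro x hx
          have hg0 : G x ≠ 0 := by
            simp only [hGdef]
            intro h0
            rw [ENNReal.rpow_eq_zero_iff] at h0
            rcases h0 with h0 | h0
            · exact hno x hx h0.1
            · have : (0:ℝ) < 1/q := by positivity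
              linarith [h0.2]
          have ht : Filter.Tendsto (fun m : ℕ => ENNReal.ofReal ((2:ℝ)^(-(m:ℤ)))) Filter.atTop (nhds 0) := by
            rw [← ENNReal.ofReal_zero]
            apply ENNReal.tendsto_ofReal
            have := tendsto_pow_atTop_nhds_zero_of_lt_one (r := (1/2:ℝ)) (by norm_num) (by norm_num)
            refine this.congr fun m => ?_
            simp
          obtain ⟨m, hm⟩ := (ht.eventually_lt_const (pos_iff_ne_zero.2 hg0)).exists
          exact mem_iUnion.2 ⟨m, hm⟩
        have hmono : Monotone fun m : ℕ => (Q i ∩ Ω (-(m:ℤ))) := fun a b hab =>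
          inter_subset_inter_right _ (hΩanti _ _ (by omega))
        have h1 : γ (Q i) ≤ γ (Q i) / 2 := by
          conv_lhs => rw [hU]
          rw [hmono.measure_iUnion]
          exact iSup_le fun m => hex _
        exact absurd h1 (not_le.2 (ENNReal.half_lt_self (hpos i) (hfin i)))
      obtain ⟨x, hx, hTx⟩ := this
      have hTx' : ∫⁻ z, ker γ cell idx x z * F z ∂μ = 0 := hTx
      have hmx : Measurable fun z => ker γ cell idx x z * F z := hkF.comp measurable_prodMk_left
      rw [lintegral_eq_zero_iff hmx] at hTx'
      filter_upwards [hTx'] with z hz h1 _ h2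
      exfalso
      simp only [Pi.zero_apply, mul_eq_zero, h2, or_false] at hz
      have hz' : ker γ cell idx x z = 0 := by simpa [h2] using hz
      rw [ker, indicator_of_mem (by rw [h1]; exact hx), ENNReal.inv_eq_zero] at hz'
      exact hfin _ hz'
    have key2 : ∀ᵐ z ∂μ, ∀ i : ℕ × V, idx z = i → z ∈ D → F z ≠ 0 → ∃ k, Good k i :=
      ae_all_iff.2 key
    filter_upwards [key2, hμD] with z hz hzD hFz
    have hex := hz _ rfl hzD hFz
    have hbd : ∃ b : ℤ, ∀ k, Good k (idx z) → k ≤ b := by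
      have hlim : ∀ k : ℤ, ENNReal.ofReal ((2:ℝ)^k) * γ (Ω k) ≤ ∫⁻ x, G x ∂γ := by
        intro k
        refine le_trans ?_ (mul_meas_ge_le_lintegral hGm (ENNReal.ofReal ((2:ℝ)^k)))
        gcongr
        intro x hx
        exact le_of_lt (show ENNReal.ofReal ((2:ℝ)^k) < G x from hx)
      have hp : 0 < γ (Q (idx z)) / 2 := ENNReal.half_pos (hpos _)
      have hpt : γ (Q (idx z)) / 2 ≠ ⊤ := ENNReal.div_ne_top (hfin _) (by simp)
      have ht : Filter.Tendsto (fun m : ℕ => ENNReal.ofReal ((2:ℝ)^(m:ℤ)) * (γ (Q (idx z)) / 2)) Filter.atTop (nhds ⊤) := by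
        have h1 : Filter.Tendsto (fun m : ℕ => ENNReal.ofReal ((2:ℝ)^(m:ℤ))) Filter.atTop (nhds ⊤) := by
          apply ENNReal.tendsto_ofReal_atTop.comp
          simpa using tendsto_pow_atTop_atTop_of_one_lt (r := (2:ℝ)) (by norm_num)
        have := ENNReal.Tendsto.mul_const (b := γ (Q (idx z)) / 2) h1 (Or.inl (by simp))
        rwa [ENNReal.top_mul hp.ne'] at this
      obtain ⟨m, hm⟩ := (ht.eventually_const_lt (lt_top_iff_ne_top.2 hG)).exists
      refine ⟨m, fun k hk => ?_⟩
      by_contra hlt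
      push Not at hlt
      have h2 := (hGoodanti m k _ hlt.le hk).2
      have h3 := (mul_le_mul_right (h2.le.trans (measure_mono inter_subset_right)) (ENNReal.ofReal ((2:ℝ)^(m:ℤ)))).trans (hlim m)
      exact absurd h3 (not_le.2 hm)
    obtain ⟨k, hk, hkmax⟩ := Int.exists_greatest_of_bdd hbd hex
    have hj : ∃ j, Good k (j, cell j (base z)) := ⟨(idx z).1, by rw [← hib z]; exact hk⟩
    refine ⟨(k, Nat.find hj, cell (Nat.find hj) (base z)), ⟨hzD, hk, fun h => ?_, rfl⟩,
      Nat.find_spec hj, fun x hx j' hj' => ?_⟩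
    · have := hkmax _ h
      simp at this
    · have : cell j' x = cell j' (base z) := hnest _ _ _ _ (le_of_lt hj') hx
      simp only [this]
      exact Nat.find_min hj hj'
  · rintro ⟨k, i⟩
    have hAm : ∀ z ∈ A (k, i), F z ≤ 2 * ∫⁻ x in Q i \ Ω (k+1), ker γ cell idx x z * F z ∂γ := by
      rintro z hz
      have hz0 := hz
      obtain ⟨⟨hzD, h1, h2, h3⟩, hi⟩ := hz
      have hsub : Q (idx z) ⊆ Q i := by
        intro x hx
        have hx' : cell (idx z).1 x = cell (idx z).1 (base z) := by rw [← hib z]; exact hx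
        exact (hnest _ _ _ _ (hgen _ _ hz0) hx').trans h3
      have hle : γ (Q (idx z) ∩ Ω (k+1)) ≤ γ (Q (idx z)) / 2 := by
        by_contra hc
        exact h2 ⟨h1.1, not_le.1 hc⟩
      have hge : γ (Q (idx z)) / 2 ≤ γ (Q (idx z) \ Ω (k+1)) := by
        have e1 := measure_inter_add_sdiff (μ := γ) (Q (idx z)) (hΩm (k+1))
        have e2 : γ (Q (idx z)) / 2 + γ (Q (idx z)) / 2 ≤ γ (Q (idx z)) / 2 + γ (Q (idx z) \ Ω (k+1)) := by
          rw [ENNReal.add_halves]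
          conv_lhs => rw [← e1]
          gcongr
        exact (ENNReal.add_le_add_iff_left (ENNReal.div_ne_top (hfin _) (by simp))).1 e2
      have hmz : Measurable fun x => ker γ cell idx x z := hkm.comp measurable_prodMk_right
      rw [lintegral_mul_const _ hmz]
      have e3 : ∫⁻ x in Q i \ Ω (k+1), ker γ cell idx x z ∂γ
          = (γ (Q (idx z)))⁻¹ * γ (Q (idx z) \ Ω (k+1)) := by
        simp only [ker]
        rw [lintegral_indicator (hQm _), Measure.restrict_restrict (hQm _), setLIntegral_const]
        congr 2
        rw [← inter_sdiff_assoc, inter_eq_left.2 hsub]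
      rw [e3]
      calc F z = 2 * ((γ (Q (idx z)))⁻¹ * (γ (Q (idx z)) / 2) * F z) := by
            rw [div_eq_mul_inv, ← mul_assoc (γ _)⁻¹, ENNReal.inv_mul_cancel (hpos _) (hfin _), one_mul,
              ← mul_assoc, ENNReal.mul_inv_cancel (by simp) (by simp), one_mul]
        _ ≤ _ := by gcongr
    calc ∫⁻ z in A (k, i), F z ∂μ
        ≤ ∫⁻ z in A (k, i), 2 * ∫⁻ x in Q i \ Ω (k+1), ker γ cell idx x z * F z ∂γ ∂μ := by
          have hm : Measurable fun z => 2 * ∫⁻ x in Q i \ Ω (k+1), ker γ cell idx x z * F z ∂γ :=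
            (hkF.lintegral_prod_left).const_mul _
          exact setLIntegral_mono hm hAm
      _ ≤ ∫⁻ z, 2 * ∫⁻ x in Q i \ Ω (k+1), ker γ cell idx x z * F z ∂γ ∂μ :=
          setLIntegral_le_lintegral _ _
      _ = 2 * ∫⁻ z, ∫⁻ x in Q i \ Ω (k+1), ker γ cell idx x z * F z ∂γ ∂μ :=
          lintegral_const_mul' _ _ (by simp)
      _ = 2 * ∫⁻ x in Q i \ Ω (k+1), T x ∂γ := by
          rw [lintegral_lintegral_swap]
          exact (hkF.comp measurable_swap).aemeasurable
      _ ≤ 2 * ∫⁻ x in Q i \ Ω (k+1), ENNReal.ofReal (2 ^ (k + 1)) ^ q ∂γ := by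
          gcongr 2 * ?_
          refine setLIntegral_mono measurable_const fun x hx => ?_
          have : T x ^ (1/q) ≤ ENNReal.ofReal (2 ^ (k + 1)) := not_lt.1 hx.2
          rw [one_div] at this
          exact (ENNReal.rpow_inv_le_iff (by linarith)).1 this
      _ ≤ _ := by
          rw [setLIntegral_const]
          gcongr
          exact sdiff_subset
  · rw [ENNReal.tsum_prod']
    have hk : ∀ k : ℤ, ∑' i : ℕ × V, S.indicator (fun i => ENNReal.ofReal (2 ^ i.1) * γ (Q i.2)) (k, i)
        ≤ 2 * (ENNReal.ofReal (2^k) * γ (Ω k)) := by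
      intro k
      have hb : ∀ i : ℕ × V, S.indicator (fun i => ENNReal.ofReal (2 ^ i.1) * γ (Q i.2)) (k, i)
          ≤ 2 * ENNReal.ofReal (2^k) * γ (if (k, i) ∈ S then Q i ∩ Ω k else ∅) := by
        intro i
        by_cases hi : (k, i) ∈ S
        · rw [indicator_of_mem hi, if_pos hi]
          have := hi.1.2.le
          simp only
          rw [ENNReal.div_le_iff (by simp) (by simp)] at this
          calc _ ≤ ENNReal.ofReal (2^k) * (γ (Q i ∩ Ω k) * 2) := by gcongr
            _ = _ := by ring
        · simp [hi]
      calc _ ≤ ∑' i : ℕ × V, 2 * ENNReal.ofReal (2^k) * γ (if (k, i) ∈ S then Q i ∩ Ω k else ∅) :=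
            ENNReal.tsum_le_tsum hb
        _ = 2 * ENNReal.ofReal (2^k) * γ (⋃ i : ℕ × V, if (k, i) ∈ S then Q i ∩ Ω k else ∅) := by
            rw [ENNReal.tsum_mul_left, measure_iUnion]
            · rintro ⟨j, v⟩ ⟨j', v'⟩ hne
              rw [Function.onFun, disjoint_left]
              intro x hx hx'
              apply hne
              split_ifs at hx with hi
              swap
              · exact absurd hx (by simp)
              split_ifs at hx' with hi'
              swap
              · exact absurd hx' (by simp)
              have hv : cell j x = v := hx.1
              have hv' : cell j' x = v' := hx'.1
              rcases lt_trichotomy j j' with h | h | h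
              · exact absurd hi.1 (by have := hi'.2 _ hx'.1 j h; rwa [hv] at this)
              · subst h; rw [← hv, ← hv']
              · exact absurd hi'.1 (by have := hi.2 _ hx.1 j' h; rwa [hv'] at this)
            · intro i; split_ifs
              · exact (hQm i).inter (hΩm k)
              · exact .empty
        _ ≤ 2 * ENNReal.ofReal (2^k) * γ (Ω k) := by
            gcongr
            apply iUnion_subset
            intro i
            split_ifs
            · exact inter_subset_right
            · simp
        _ = _ := by ring
    calc _ ≤ ∑' k : ℤ, 2 * (ENNReal.ofReal (2^k) * γ (Ω k)) := ENNReal.tsum_le_tsum hk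
      _ = 2 * ∑' k : ℤ, (ENNReal.ofReal (2^k) * γ (Ω k)) := ENNReal.tsum_mul_left
      _ = 2 * ∑' k : ℤ, ∫⁻ x, (Ω k).indicator (fun _ => ENNReal.ofReal (2^k)) x ∂γ := by
          congr 2; ext k
          rw [lintegral_indicator (hΩm k), setLIntegral_const]
      _ = 2 * ∫⁻ x, ∑' k : ℤ, (Ω k).indicator (fun _ => ENNReal.ofReal (2^k)) x ∂γ := by
          rw [lintegral_tsum]
          exact fun k => (measurable_const.indicator (hΩm k)).aemeasurable
      _ ≤ 2 * ∫⁻ x, 2 * G x ∂γ := by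
          gcongr with x
          refine le_trans (le_of_eq ?_) (dyadic_sum_le (G x))
          refine tsum_congr fun k => ?_
          simp only [indicator, hΩ, mem_ofPred_eq]
      _ = 4 * ∫⁻ x, G x ∂γ := by
          rw [lintegral_const_mul' _ _ (by simp), ← mul_assoc]; norm_num
end abstr

/-! Concrete geometry. -/

instance instSFiniteGaussianM (n : ℕ) : SFinite (gaussianM n) := by
  unfold gaussianM; infer_instance

instance instSFiniteDMeasure (n : ℕ) : SFinite (DMeasure n) := by
  unfold DMeasure tMeasure; infer_instance

lemma mFun_eq {n : ℕ} (x : E n) : mFun x = (max 1 ‖x‖)⁻¹ := by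
  unfold mFun
  split_ifs with h
  · rw [max_eq_left h, inv_one]
  · rw [max_eq_right (not_le.1 h).le]

lemma mFun_pos {n : ℕ} (x : E n) : 0 < mFun x := by
  rw [mFun_eq]; positivity

lemma mFun_le_one {n : ℕ} (x : E n) : mFun x ≤ 1 := by
  rw [mFun_eq]; exact inv_le_one_of_one_le₀ (le_max_left _ _)

lemma mFun_mul_norm_le {n : ℕ} (x : E n) : mFun x * ‖x‖ ≤ 1 := by
  rw [mFun_eq, inv_mul_le_iff₀ (by positivity)]; simp

lemma mFun_le_mul {n : ℕ} (x y : E n) {e : ℝ} (h : dist x y ≤ e) :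
    mFun x ≤ (1 + e) * mFun y := by
  have he : 0 ≤ e := dist_nonneg.trans h
  rw [mFun_eq, mFun_eq, ← div_eq_mul_inv, inv_le_comm₀ (by positivity) (by positivity), inv_div,
    div_le_iff₀ (by positivity)]
  have h1 : ‖y‖ ≤ ‖x‖ + e := by
    have := norm_le_norm_add_norm_sub x y
    rw [dist_eq_norm] at h
    linarith
  have h2 : 1 ≤ max 1 ‖x‖ := le_max_left _ _
  have h3 : ‖x‖ ≤ max 1 ‖x‖ := le_max_right _ _
  apply max_le <;> nlinarith

lemma meas_mFun (n : ℕ) : Measurable (mFun : E n → ℝ) := by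
  have : (mFun : E n → ℝ) = fun x => (max 1 ‖x‖)⁻¹ := funext mFun_eq
  rw [this]
  fun_prop

lemma meas_Dset (n : ℕ) : MeasurableSet (Dset n) :=
  (measurableSet_lt measurable_const measurable_snd).inter
    (measurableSet_lt measurable_snd ((meas_mFun n).comp measurable_fst))

/-- generation of a height -/
def genT (t : ℝ) : ℕ := ⌊-Real.logb 2 t⌋₊

lemma meas_genT : Measurable genT :=
  Nat.measurable_floor.comp (by unfold Real.logb; fun_prop)

lemma genT_spec {t : ℝ} (h0 : 0 < t) (h1 : t ≤ 1) :
    (1/2:ℝ)^(genT t) / 2 < t ∧ t ≤ (1/2:ℝ)^(genT t) := by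
  have hu : 0 ≤ -Real.logb 2 t := by
    have := Real.logb_nonpos (b := 2) (by norm_num) h0.le h1
    linarith
  have e1 := Nat.floor_le hu
  have e2 := Nat.lt_floor_add_one (-Real.logb 2 t)
  change ((genT t : ℕ) : ℝ) ≤ _ at e1
  change _ < ((genT t : ℕ) : ℝ) + 1 at e2
  have hp : ∀ m : ℕ, (1/2:ℝ)^m = (2:ℝ)^(-(m:ℝ)) := by
    intro m
    rw [Real.rpow_neg (by norm_num), Real.rpow_natCast]; simp
  constructor
  · have : (1/2:ℝ)^(genT t) / 2 = (1/2:ℝ)^(genT t + 1) := by rw [pow_succ]; ring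
    rw [this, hp, ← Real.lt_logb_iff_rpow_lt (by norm_num) h0]
    push_cast; linarith
  · rw [hp, ← Real.logb_le_iff_le_rpow (by norm_num) h0]
    linarith

/-- dyadic cell index -/
def cellE (n : ℕ) (δ : ℝ) (j : ℕ) (x : E n) : Fin n → ℤ := fun i => ⌊x i * 2^j / δ⌋

lemma meas_cellE (n : ℕ) (δ : ℝ) (j : ℕ) : Measurable (cellE n δ j) := by
  refine measurable_pi_lambda _ fun i => ?_
  refine Int.measurable_floor.comp ?_
  fun_prop

lemma cellE_nest (n : ℕ) (δ : ℝ) (j j' : ℕ) (x y : E n) (h : j ≤ j')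
    (hxy : cellE n δ j' x = cellE n δ j' y) : cellE n δ j x = cellE n δ j y := by
  funext i
  obtain ⟨m, rfl⟩ := Nat.exists_eq_add_of_le h
  have key : ∀ z : E n, cellE n δ j z i = cellE n δ (j+m) z i / ((2^m : ℕ) : ℤ) := by
    intro z
    simp only [cellE]
    rw [← Int.floor_div_natCast]
    congr 1
    push_cast
    rw [pow_add]
    field_simp
  rw [key, key, hxy]

lemma cellE_dist (n : ℕ) {δ : ℝ} (hδ : 0 < δ) (j : ℕ) (x y : E n)
    (h : cellE n δ j x = cellE n δ j y) : dist x y ≤ n * δ * (1/2)^j := by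
  have hc : ∀ i, |x i - y i| ≤ δ * (1/2)^j := by
    intro i
    have hi : ⌊x i * 2^j / δ⌋ = ⌊y i * 2^j / δ⌋ := congrFun h i
    have := (Int.abs_sub_lt_one_of_floor_eq_floor hi).le
    have e : x i * 2^j / δ - y i * 2^j / δ = (x i - y i) * (2^j / δ) := by ring
    rw [e, abs_mul, abs_of_pos (by positivity : (0:ℝ) < 2^j/δ), ← le_div_iff₀ (by positivity)] at this
    refine this.trans (le_of_eq ?_)
    simp [div_eq_mul_inv]
  rw [EuclideanSpace.dist_eq]
  apply Real.sqrt_le_iff.2 ⟨by positivity, ?_⟩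
  calc ∑ i, dist (x i) (y i) ^ 2 ≤ ∑ i : Fin n, (δ * (1/2)^j)^2 := by
        apply Finset.sum_le_sum
        intro i _
        rw [Real.dist_eq]
        exact pow_le_pow_left₀ (abs_nonneg _) (hc i) 2
    _ = n * (δ * (1/2)^j)^2 := by simp
    _ ≤ (n * δ * (1/2)^j)^2 := by
        have : (n:ℝ) ≤ (n:ℝ)^2 := by exact_mod_cast Nat.le_self_pow (by norm_num) n
        calc _ ≤ (n:ℝ)^2 * (δ * (1/2)^j)^2 := by gcongr
          _ = _ := by ring

/-- midpoint of a cell -/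
def midE (n : ℕ) (δ : ℝ) (i : ℕ × (Fin n → ℤ)) : E n :=
  WithLp.toLp 2 fun l => ((i.2 l : ℝ) + 1/2) * (δ * (1/2)^i.1)

lemma ball_mid_subset (n : ℕ) {δ : ℝ} (hδ : 0 < δ) (i : ℕ × (Fin n → ℤ)) :
    ball (midE n δ i) (δ * (1/2)^i.1 / 2) ⊆ Qc (cellE n δ) i := by
  intro x hx
  rw [mem_ball, dist_eq_norm] at hx
  change cellE n δ i.1 x = i.2
  funext l
  have h1 := (PiLp.norm_apply_le (x - midE n δ i) l).trans_lt hx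
  rw [Real.norm_eq_abs, abs_lt] at h1
  have e : (x - midE n δ i) l = x l - ((i.2 l : ℝ) + 1/2) * (δ * (1/2)^i.1) := by
    simp [midE]
  rw [e] at h1
  have hs : 0 < δ * (1/2:ℝ)^i.1 := by positivity
  have e2 : x l * 2^i.1 / δ = x l / (δ * (1/2)^i.1) := by
    simp; field_simp
  simp only [cellE]
  rw [Int.floor_eq_iff, e2, le_div_iff₀ hs, div_lt_iff₀ hs]
  constructor <;> nlinarith

lemma mid_mem (n : ℕ) {δ : ℝ} (hδ : 0 < δ) (i : ℕ × (Fin n → ℤ)) :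
    midE n δ i ∈ Qc (cellE n δ) i :=
  ball_mid_subset n hδ i (mem_ball_self (by positivity))

/-- Gaussian density -/
def gdens (n : ℕ) (x : E n) : ℝ := (2 * Real.pi) ^ (-(n : ℝ) / 2) * Real.exp (-‖x‖ ^ 2 / 2)

lemma gdens_pos (n : ℕ) (x : E n) : 0 < gdens n x := by unfold gdens; positivity

lemma gaussianM_apply (n : ℕ) {s : Set (E n)} (hs : MeasurableSet s) :
    gaussianM n s = ∫⁻ x in s, ENNReal.ofReal (gdens n x) := by
  rw [gaussianM, withDensity_apply _ hs]; rfl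

lemma doubling (n : ℕ) (hn : 1 ≤ n) (K L : ℝ) (hK : 0 ≤ K) (hL : 0 ≤ L) : ∃ C : ℝ, 1 ≤ C ∧
    ∀ (x c : E n) (R r : ℝ), 0 < r → R ≤ K * mFun x → R ≤ L * r → ball c r ⊆ ball x R →
      gaussianM n (ball x R) ≤ ENNReal.ofReal C * gaussianM n (ball c r) := by
  have : Nonempty (Fin n) := ⟨⟨0, hn⟩⟩
  have : Nontrivial (E n) := inferInstance
  set M : ℝ := (2 * K + K^2) / 2
  refine ⟨max 1 (Real.exp (M + M) * L^n), le_max_left _ _, fun x c R r hr hRK hRL hsub => ?_⟩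
  have hR : 0 < R := by
    have := hsub (mem_ball_self hr)
    exact dist_nonneg.trans_lt this
  have hm1 := mFun_le_one x
  have hm0 := mFun_pos x
  have hmn := mFun_mul_norm_le x
  have hdens : ∀ z ∈ ball x R, gdens n z ≤ gdens n x * Real.exp M ∧
      gdens n x * Real.exp (-M) ≤ gdens n z := by
    intro z hz
    rw [mem_ball, dist_eq_norm] at hz
    have h1 : ‖z‖ ≤ ‖x‖ + R := by
      have := norm_le_norm_add_norm_sub x z; rw [norm_sub_rev] at this; linarith
    have h2 : ‖x‖ ≤ ‖z‖ + R := by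
      have := norm_le_norm_add_norm_sub z x; linarith
    have h3 : R * ‖x‖ ≤ K := by
      calc R * ‖x‖ ≤ K * mFun x * ‖x‖ := by gcongr
        _ = K * (mFun x * ‖x‖) := by ring
        _ ≤ K * 1 := by gcongr
        _ = K := mul_one K
    have h4 : R ≤ K := hRK.trans (by nlinarith)
    have h5 : R * R ≤ K^2 := by nlinarith
    have hz0 := norm_nonneg z
    have hx0 := norm_nonneg x
    have h6 : ‖z‖^2 ≤ ‖x‖^2 + 2 * M := by
      calc ‖z‖^2 ≤ (‖x‖ + R)^2 := by gcongr
        _ ≤ _ := by simp only [M]; nlinarith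
    have h7 : ‖x‖^2 ≤ ‖z‖^2 + 2 * M := by
      by_cases hc : ‖x‖ ≤ R
      · simp only [M]; nlinarith
      · have : (‖x‖ - R)^2 ≤ ‖z‖^2 := by
          apply pow_le_pow_left₀ <;> linarith
        simp only [M]; nlinarith
    unfold gdens
    constructor
    · rw [mul_assoc, ← Real.exp_add]
      gcongr
      linarith
    · rw [mul_assoc, ← Real.exp_add]
      gcongr
      linarith
  have hup : gaussianM n (ball x R) ≤ ENNReal.ofReal (gdens n x * Real.exp M) * volume (ball x R) := by
    rw [gaussianM_apply n measurableSet_ball, ← setLIntegral_const]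
    exact setLIntegral_mono measurable_const fun z hz => ENNReal.ofReal_le_ofReal (hdens z hz).1
  have hlo : ENNReal.ofReal (gdens n x * Real.exp (-M)) * volume (ball c r) ≤ gaussianM n (ball c r) := by
    rw [gaussianM_apply n measurableSet_ball, ← setLIntegral_const]
    refine setLIntegral_mono' measurableSet_ball fun z hz => ENNReal.ofReal_le_ofReal (hdens z (hsub hz)).2
  have hg := gdens_pos n x
  calc gaussianM n (ball x R) ≤ _ := hup
    _ = ENNReal.ofReal (gdens n x * Real.exp M) * (ENNReal.ofReal (R^n) * volume (ball (0 : E n) 1)) := by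
        rw [Measure.addHaar_ball _ _ hR.le]; simp
    _ ≤ ENNReal.ofReal (gdens n x * Real.exp M) * (ENNReal.ofReal (L^n * r^n) * volume (ball (0 : E n) 1)) := by
        gcongr
        rw [← mul_pow]
        gcongr
    _ = ENNReal.ofReal (Real.exp (M + M) * L^n) * (ENNReal.ofReal (gdens n x * Real.exp (-M)) * volume (ball c r)) := by
        rw [Measure.addHaar_ball _ _ hr.le, ← mul_assoc, ← mul_assoc, ← mul_assoc,
          ← ENNReal.ofReal_mul (by positivity), ← ENNReal.ofReal_mul (by positivity),
          finrank_euclideanSpace_fin, ← ENNReal.ofReal_mul (by positivity)]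
        congr 2
        rw [Real.exp_add, Real.exp_neg]
        field_simp
    _ ≤ ENNReal.ofReal (max 1 (Real.exp (M + M) * L^n)) * gaussianM n (ball c r) := by
        gcongr
        exact le_max_right _ _

lemma gaussianM_Qc_pos (n : ℕ) {δ : ℝ} (hδ : 0 < δ) (i : ℕ × (Fin n → ℤ)) :
    gaussianM n (Qc (cellE n δ) i) ≠ 0 := by
  intro h
  have hac : (volume : Measure (E n)) ≪ gaussianM n := by
    apply withDensity_absolutelyContinuous'
    · apply Measurable.aemeasurable; fun_prop
    · refine Filter.Eventually.of_forall fun x => ?_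
      have := gdens_pos n x
      simpa [gdens] using this
  have h2 := measure_mono_null (ball_mid_subset n hδ i) (hac h)
  exact absurd h2 (measure_ball_pos _ _ (by positivity)).ne'

lemma gaussianM_Qc_fin (n : ℕ) {δ : ℝ} (hδ : 0 < δ) (i : ℕ × (Fin n → ℤ)) :
    gaussianM n (Qc (cellE n δ) i) ≠ ⊤ := by
  have hsub : Qc (cellE n δ) i ⊆ closedBall (midE n δ i) (n * δ * (1/2)^i.1) := by
    intro x hx
    exact cellE_dist n hδ i.1 _ _ ((show cellE n δ i.1 x = i.2 from hx).trans (mid_mem n hδ i).symm)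
  refine ne_top_of_le_ne_top ?_ (measure_mono hsub)
  rw [gaussianM_apply n measurableSet_closedBall]
  refine ne_top_of_le_ne_top ?_ (setLIntegral_mono (g := fun _ => ENNReal.ofReal ((2 * Real.pi) ^ (-(n : ℝ) / 2))) measurable_const fun z hz => ENNReal.ofReal_le_ofReal ?_)
  · rw [setLIntegral_const]
    exact ENNReal.mul_ne_top (by simp) measure_closedBall_lt_top.ne
  · unfold gdens
    apply mul_le_of_le_one_right (by positivity)
    rw [Real.exp_le_one_iff]
    have := sq_nonneg ‖z‖
    linarith

lemma isTAtom_zero (n : ℕ) (q α : ℝ) (hq : 1 < q) (hα : 1 < α) : IsTAtom n q α (fun _ => 0) := by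
  refine ⟨measurable_const, 0, 0, le_rfl, ?_, fun _ _ => rfl, ?_⟩
  · have := mFun_pos (0 : E n); positivity
  · have : (0:ℝ) < q := by linarith
    simp [ENNReal.zero_rpow_of_pos this, this]

lemma atom_arith {q C1 : ℝ} (hq : 1 < q) (hC1 : 1 ≤ C1) (k : ℤ) {g β I : ℝ≥0∞} (hg0 : g ≠ 0)
    (hgt : g ≠ ⊤) (hβ : β ≤ ENNReal.ofReal C1 * g)
    (hI : I ≤ 2 * (ENNReal.ofReal (2 ^ (k + 1)) ^ q * g)) :
    ((ENNReal.ofReal (4 * C1) * (ENNReal.ofReal (2 ^ k) * g))⁻¹ ^ q * I) ^ (1/q) ≤ β ^ (-(1 - 1/q)) := by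
  have hq0 : (0:ℝ) < q := by linarith
  set c := ENNReal.ofReal C1
  set L := ENNReal.ofReal (4 * C1) * (ENNReal.ofReal (2 ^ k) * g) with hL
  have hLeq : L = 2 * ENNReal.ofReal (2 ^ (k+1)) * (c * g) := by
    rw [hL, ← mul_assoc, ← ENNReal.ofReal_mul (by positivity), ← ENNReal.ofReal_ofNat 2,
      ← mul_assoc, ← ENNReal.ofReal_mul (by positivity), ← ENNReal.ofReal_mul (by positivity)]
    congr 2
    rw [zpow_add_one₀ (by norm_num)]; ring
  have hc1 : 1 ≤ c := ENNReal.one_le_ofReal.2 hC1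
  have hc0 : c ≠ 0 := (zero_lt_one.trans_le hc1).ne'
  have hcg0 : c * g ≠ 0 := mul_ne_zero hc0 hg0
  have hcgt : c * g ≠ ⊤ := ENNReal.mul_ne_top (by simp [c]) hgt
  have hL0 : L ≠ 0 := by
    rw [hLeq]
    refine mul_ne_zero (mul_ne_zero (by simp) ?_) hcg0
    simp; positivity
  have hLt : L ≠ ⊤ := by
    rw [hLeq]; exact ENNReal.mul_ne_top (ENNReal.mul_ne_top (by simp) (by simp)) hcgt
  have e1 : (L⁻¹ ^ q * I) ^ (1/q) = L⁻¹ * I ^ (1/q) := by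
    rw [ENNReal.mul_rpow_of_nonneg _ _ (by positivity), ← ENNReal.rpow_mul, mul_one_div_cancel hq0.ne',
      ENNReal.rpow_one]
  have e2 : I ^ (1/q) ≤ 2 * ENNReal.ofReal (2 ^ (k+1)) * (c * g) ^ (1/q) := by
    calc I ^ (1/q) ≤ (2 * (ENNReal.ofReal (2 ^ (k + 1)) ^ q * g)) ^ (1/q) := by gcongr
      _ = 2 ^ (1/q) * (ENNReal.ofReal (2 ^ (k+1)) * g ^ (1/q)) := by
          rw [ENNReal.mul_rpow_of_nonneg _ _ (by positivity), ENNReal.mul_rpow_of_nonneg _ _ (by positivity),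
            ← ENNReal.rpow_mul, mul_one_div_cancel hq0.ne', ENNReal.rpow_one]
      _ ≤ 2 ^ (1:ℝ) * (ENNReal.ofReal (2 ^ (k+1)) * (c * g) ^ (1/q)) := by
          gcongr
          · norm_num
          · rw [div_le_one hq0]; exact hq.le
          · exact le_mul_of_one_le_left' hc1
      _ = _ := by rw [ENNReal.rpow_one]; ring
  have e3 : (c * g) ^ (1/q) = (c * g) * (c * g) ^ (-(1 - 1/q)) := by
    conv_rhs => enter [1]; rw [← ENNReal.rpow_one (c * g)]
    rw [← ENNReal.rpow_add _ _ hcg0 hcgt]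
    congr 1; ring
  calc _ = L⁻¹ * I ^ (1/q) := e1
    _ ≤ L⁻¹ * (2 * ENNReal.ofReal (2 ^ (k+1)) * (c * g) ^ (1/q)) := by gcongr
    _ = L⁻¹ * L * (c * g) ^ (-(1 - 1/q)) := by rw [e3, hLeq]; ring
    _ = (c * g) ^ (-(1 - 1/q)) := by rw [ENNReal.inv_mul_cancel hL0 hLt, one_mul]
    _ ≤ β ^ (-(1 - 1/q)) := by
        rw [ENNReal.rpow_neg, ENNReal.rpow_neg]
        apply ENNReal.inv_le_inv.2
        apply ENNReal.rpow_le_rpow hβ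
        rw [sub_nonneg, div_le_one hq0]; exact hq.le

/-- Atomic decomposition: for `α > 1` there is `C`, depending only on `α`, `q`, `n`, such
that every measurable `f` with `‖f‖_{T^{1,q}(γ)} < ∞` can be written `f = Σ λ_k a_k` a.e.
on `D` with `T^{1,q}(γ)` `α`-atoms `a_k` and `Σ|λ_k| ≤ C ‖f‖_{T^{1,q}(γ)}`. -/
theorem stmt15 (n : ℕ) (hn : 1 ≤ n) (q : ℝ) (hq : 1 < q) (α : ℝ) (hα : 1 < α) :
    ∃ C : ℝ, 0 < C ∧
      ∀ f : E n × ℝ → ℂ, Measurable f → Tnorm n q f < ⊤ →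
        ∃ (lam : ℕ → ℂ) (a : ℕ → E n × ℝ → ℂ),
          Summable (fun k => ‖lam k‖) ∧
          (∀ k, IsTAtom n q α (a k)) ∧
          (∀ᵐ p ∂(DMeasure n), HasSum (fun k => lam k * a k p) (f p)) ∧
          ENNReal.ofReal (∑' k, ‖lam k‖) ≤ ENNReal.ofReal C * Tnorm n q f := by
  classical
  have hq0 : (0:ℝ) < q := by linarith
  have hn0 : (0:ℝ) < n := by exact_mod_cast hn
  -- constants
  obtain ⟨ε, hε0, hε4, hεα⟩ : ∃ ε : ℝ, 0 < ε ∧ ε ≤ 1/4 ∧ 5 * ε ≤ α - 1 :=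
    ⟨min (1/4) ((α-1)/5), lt_min (by norm_num) (by linarith), min_le_left _ _, by
      have := min_le_right (1/4) ((α-1)/5); linarith⟩
  set δ : ℝ := ε / n with hδdef
  have hδ : 0 < δ := by positivity
  have hnδ : n * δ = ε := by rw [hδdef]; field_simp
  set cell := cellE n δ with hcelldef
  have hdist : ∀ (i : ℕ × (Fin n → ℤ)) (x y : E n), x ∈ Qc cell i → y ∈ Qc cell i →
      dist x y ≤ ε * (1/2)^i.1 := by
    intro i x y hx hy
    have := cellE_dist n hδ i.1 x y
      ((show cell i.1 x = i.2 from hx).trans (show cell i.1 y = i.2 from hy).symm)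
    rwa [hnδ] at this
  set idx : E n × ℝ → ℕ × (Fin n → ℤ) := fun p => (genT p.2, cell (genT p.2) p.1) with hidxdef
  have hidx : Measurable idx := by
    refine (meas_genT.comp measurable_snd).prodMk ?_
    have hu : Measurable (fun w : ℕ × E n => cell w.1 w.2) :=
      measurable_from_prod_countable_right fun j => meas_cellE n δ j
    exact hu.comp ((meas_genT.comp measurable_snd).prodMk measurable_fst)
  have hself : ∀ p : E n × ℝ, p.1 ∈ Qc cell (idx p) := fun p => rfl
  have hDgen : ∀ p ∈ Dset n, (1/2:ℝ)^((idx p).1) / 2 < p.2 ∧ p.2 ≤ (1/2:ℝ)^((idx p).1) := by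
    intro p hp
    exact genT_spec hp.1 (hp.2.le.trans (mFun_le_one _))
  obtain ⟨C0, hC0, hdb0⟩ := doubling n hn 1 (2/δ) (by norm_num) (by positivity)
  obtain ⟨C1, hC1, hdb1⟩ := doubling n hn α (4/δ) (by linarith) (by positivity)
  have hker : ∀ p ∈ Dset n, ∀ x, ker (gaussianM n) cell idx x p ≤
      ENNReal.ofReal C0 * (ball p.1 p.2).indicator (fun _ => (gaussianM n (ball p.1 p.2))⁻¹) x := by
    intro p hp x
    unfold ker
    by_cases hx : x ∈ Qc cell (idx p)
    swap
    · simp [hx]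
    have hg := hDgen p hp
    have hh : (0:ℝ) < (1/2)^((idx p).1) := by positivity
    have hsub : Qc cell (idx p) ⊆ ball p.1 p.2 := by
      intro y hy
      have := hdist _ _ _ hy (hself p)
      rw [mem_ball]
      nlinarith
    rw [indicator_of_mem hx, indicator_of_mem (hsub hx)]
    have h1 : gaussianM n (ball p.1 p.2) ≤ ENNReal.ofReal C0 * gaussianM n (Qc cell (idx p)) := by
      refine (hdb0 p.1 (midE n δ (idx p)) p.2 (δ * (1/2)^(idx p).1 / 2) (by positivity)
        (by rw [one_mul]; exact hp.2.le) ?_ ((ball_mid_subset n hδ _).trans hsub)).trans ?_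
      · refine hg.2.trans (le_of_eq ?_)
        field_simp
      · gcongr
        exact ball_mid_subset n hδ _
    have hc0 : ENNReal.ofReal C0 ≠ 0 := by simp; linarith
    calc (gaussianM n (Qc cell (idx p)))⁻¹
        = ENNReal.ofReal C0 * (ENNReal.ofReal C0 * gaussianM n (Qc cell (idx p)))⁻¹ := by
          rw [ENNReal.mul_inv (Or.inl hc0) (Or.inl (by simp)), ← mul_assoc,
            ENNReal.mul_inv_cancel hc0 (by simp), one_mul]
      _ ≤ _ := by
          gcongr
  refine ⟨16 * C1 * C0 ^ (1/q), by positivity, fun f hf hfin => ?_⟩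
  set F : E n × ℝ → ℝ≥0∞ := fun p => (‖f p‖₊ : ℝ≥0∞) ^ q with hFdef
  have hF : Measurable F := by
    have : Measurable fun p => (‖f p‖₊ : ℝ≥0∞) := hf.nnnorm.coe_nnreal_ennreal
    exact this.pow_const q
  have hDae : ∀ᵐ p ∂(DMeasure n), p ∈ Dset n := ae_restrict_mem (meas_Dset n)
  have hGle : ∫⁻ x, (∫⁻ p, ker (gaussianM n) cell idx x p * F p ∂(DMeasure n)) ^ (1/q) ∂(gaussianM n)
      ≤ ENNReal.ofReal (C0 ^ (1/q)) * Tnorm n q f := by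
    unfold Tnorm
    rw [← lintegral_const_mul' _ _ (by simp)]
    refine lintegral_mono fun x => ?_
    rw [← ENNReal.ofReal_rpow_of_pos (by linarith), ← ENNReal.mul_rpow_of_nonneg _ _ (by positivity),
      ← lintegral_const_mul' _ _ (by simp)]
    refine ENNReal.rpow_le_rpow (lintegral_mono_ae ?_) (by positivity)
    filter_upwards [hDae] with p hp
    rw [← mul_assoc]
    exact mul_le_mul_left (hker p hp x) _
  have hGfin : ∫⁻ x, (∫⁻ p, ker (gaussianM n) cell idx x p * F p ∂(DMeasure n)) ^ (1/q) ∂(gaussianM n)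
      ≠ ⊤ := ne_top_of_le_ne_top (ENNReal.mul_ne_top (by simp) hfin.ne) hGle
  obtain ⟨A, S, hAm, hAdisj, hAcov, hAD, hAbase, hAS, hSadm, hAint, hSsum⟩ :=
    abstract_decomp (gaussianM n) (DMeasure n) cell (meas_cellE n δ) (cellE_nest n δ) idx hidx
      Prod.fst measurable_fst (fun _ => rfl) (Dset n) (meas_Dset n) hDae
      (gaussianM_Qc_pos n hδ) (gaussianM_Qc_fin n hδ) F hF q hq hGfin
  -- coefficients
  set L : ℤ × ℕ × (Fin n → ℤ) → ℝ≥0∞ := fun i => ENNReal.ofReal (4 * C1) *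
    S.indicator (fun i => ENNReal.ofReal (2 ^ i.1) * gaussianM n (Qc cell i.2)) i with hLdef
  have hLsum : ∑' i, L i ≤ ENNReal.ofReal (16 * C1 * C0 ^ (1/q)) * Tnorm n q f := by
    simp only [hLdef]
    rw [ENNReal.tsum_mul_left]
    calc _ ≤ ENNReal.ofReal (4 * C1) * (4 * (ENNReal.ofReal (C0 ^ (1/q)) * Tnorm n q f)) := by
          refine mul_le_mul_right (hSsum.trans (mul_le_mul_right hGle _)) _
      _ = _ := by
          rw [← mul_assoc, ← mul_assoc, ← ENNReal.ofReal_ofNat 4, ← ENNReal.ofReal_mul (by positivity),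
            ← ENNReal.ofReal_mul (by positivity)]
          congr 2; ring
  have hLfin : ∑' i, L i ≠ ⊤ := ne_top_of_le_ne_top (ENNReal.mul_ne_top (by simp) hfin.ne) hLsum
  have hLS : ∀ i ∈ S, L i = ENNReal.ofReal (4 * C1) *
      (ENNReal.ofReal (2 ^ i.1) * gaussianM n (Qc cell i.2)) := by
    intro i hi
    simp only [hLdef, indicator_of_mem hi]
  have hL0 : ∀ i ∈ S, L i ≠ 0 := by
    intro i hi
    rw [hLS i hi]
    refine mul_ne_zero ?_ (mul_ne_zero ?_ (gaussianM_Qc_pos n hδ _))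
    · simp; linarith
    · simp; positivity
  have hLt : ∀ i, L i ≠ ⊤ := fun i => ENNReal.ne_top_of_tsum_ne_top hLfin i
  -- atoms
  set a : ℤ × ℕ × (Fin n → ℤ) → E n × ℝ → ℂ := fun i =>
    (A i).indicator (fun p => (((L i).toReal : ℂ))⁻¹ * f p) with hadef
  have hatom : ∀ i, IsTAtom n q α (a i) := by
    intro i
    by_cases hi : i ∈ S
    swap
    · have hz : a i = fun _ => 0 := by
        funext p
        simp only [hadef]
        rw [indicator_of_notMem fun hp => hi (hAS i p hp)]
      rw [hz]
      exact isTAtom_zero n q α hq hα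
    obtain ⟨p0, hp0, hp0i⟩ := hSadm i hi
    have hg0 := hDgen p0 hp0
    have hp0Q : p0.1 ∈ Qc cell i.2 := by rw [← hp0i]; exact hself p0
    rw [hp0i] at hg0
    set h : ℝ := (1/2)^i.2.1 with hh
    have hh0 : 0 < h := by positivity
    have hh1 : h ≤ 1 := pow_le_one₀ (by norm_num) (by norm_num)
    set c := midE n δ i.2 with hc
    have hcQ : c ∈ Qc cell i.2 := mid_mem n hδ i.2
    have hmc := mFun_pos c
    have hmle : ∀ y ∈ Qc cell i.2, mFun y ≤ (1 + ε) * mFun c := by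
      intro y hy
      have h1 : dist y c ≤ ε := (hdist _ _ _ hy hcQ).trans (by nlinarith)
      exact mFun_le_mul y c h1
    have hhm : h ≤ 2 * ((1 + ε) * mFun c) := by
      have := hmle _ hp0Q
      have := hp0.2
      linarith
    have hεε : ε * ε ≤ ε := by nlinarith
    have hεh : ε * h + (1 + ε) * mFun c ≤ α * mFun c := by
      calc ε * h + (1 + ε) * mFun c ≤ ε * (2 * ((1 + ε) * mFun c)) + (1 + ε) * mFun c := by gcongr
        _ = (1 + 3 * ε + 2 * (ε * ε)) * mFun c := by ring
        _ ≤ α * mFun c := by gcongr; linarith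
    have hr0 : 0 ≤ min (α * mFun c) (2 * h) := le_min (by positivity) (by positivity)
    have hQsub : Qc cell i.2 ⊆ ball c (min (α * mFun c) (2 * h)) := by
      intro y hy
      have h1 := hdist _ _ _ hy hcQ
      rw [mem_ball]
      refine lt_min ?_ ?_
      · have : 0 < (1 + ε) * mFun c := by positivity
        linarith
      · nlinarith
    refine ⟨(hf.const_mul _).indicator (hAm i), c, min (α * mFun c) (2 * h), hr0, min_le_left _ _, ?_, ?_⟩
    · intro p hp
      simp only [hadef]
      apply indicator_of_notMem
      intro hpA
      apply hp
      have hpD := hAD i hpA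
      refine ⟨⟨hpD.1, ?_⟩, hpD⟩
      obtain ⟨hpQ, hpg⟩ := hAbase i p hpA
      have hgp := hDgen p hpD
      have ht : p.2 ≤ h := hgp.2.trans (pow_le_pow_of_le_one (by norm_num) (by norm_num) hpg)
      have hd := hdist _ _ _ hpQ hcQ
      have hne : (ball c (min (α * mFun c) (2 * h)))ᶜ.Nonempty := by
        have : Nonempty (Fin n) := ⟨⟨0, hn⟩⟩
        have : Nontrivial (E n) := inferInstance
        obtain ⟨z, hz⟩ := NormedSpace.exists_lt_norm ℝ (E n) (‖c‖ + min (α * mFun c) (2 * h))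
        refine ⟨z, ?_⟩
        rw [mem_compl_iff, mem_ball, not_lt, dist_eq_norm]
        have := norm_le_norm_add_norm_sub c z
        rw [norm_sub_rev] at this
        linarith
      rw [one_mul, le_infDist hne]
      intro z hz
      rw [mem_compl_iff, mem_ball, not_lt] at hz
      have htri := dist_triangle z p.1 c
      rw [dist_comm z p.1] at htri
      have hm := hmle _ hpQ
      have hpt := hpD.2
      have : dist p.1 c + p.2 ≤ min (α * mFun c) (2 * h) := by
        refine le_min ?_ ?_
        · linarith
        · nlinarith
      linarith
    · have hβ : gaussianM n (ball c (min (α * mFun c) (2 * h))) ≤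
          ENNReal.ofReal C1 * gaussianM n (Qc cell i.2) := by
        refine (hdb1 c c (min (α * mFun c) (2 * h)) (δ * h / 2) (by positivity)
          (min_le_left _ _) ?_ ((ball_mid_subset n hδ _).trans hQsub)).trans ?_
        · refine (min_le_right _ _).trans (le_of_eq ?_)
          field_simp; norm_num
        · gcongr
          exact ball_mid_subset n hδ _
      have hint : ∫⁻ p, (‖a i p‖₊ : ℝ≥0∞) ^ q ∂(DMeasure n)
          = (L i)⁻¹ ^ q * ∫⁻ p in A i, F p ∂(DMeasure n) := by
        rw [← lintegral_const_mul' _ _ (by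
          exact ENNReal.rpow_ne_top_of_nonneg hq0.le (ENNReal.inv_ne_top.2 (hL0 i hi))),
          ← lintegral_indicator (hAm i)]
        refine lintegral_congr fun p => ?_
        by_cases hp : p ∈ A i
        · simp only [hadef, indicator_of_mem hp, hFdef]
          rw [← ENNReal.mul_rpow_of_nonneg _ _ hq0.le, nnnorm_mul, ENNReal.coe_mul]
          congr 2
          have hpos := ENNReal.toReal_pos (hL0 i hi) (hLt i)
          rw [← ENNReal.ofReal_toReal (hLt i), ← ENNReal.ofReal_inv_of_pos hpos,
            ENNReal.toReal_ofReal hpos.le, ← enorm_eq_nnnorm, ← ofReal_norm]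
          simp
        · simp only [hadef, indicator_of_notMem hp]
          simp [hq0]
      rw [hint, hLS i hi]
      exact atom_arith hq hC1 i.1 (gaussianM_Qc_pos n hδ _) (gaussianM_Qc_fin n hδ _) hβ (hAint i)
  -- reindex
  have : Infinite (ℤ × ℕ × (Fin n → ℤ)) := inferInstance
  obtain ⟨hden⟩ := nonempty_denumerable (ℤ × ℕ × (Fin n → ℤ))
  let e : ℕ ≃ ℤ × ℕ × (Fin n → ℤ) := (Denumerable.eqv _).symm
  have hnorm : ∀ i, ‖((L i).toReal : ℂ)‖ = (L i).toReal := fun i => by simp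
  refine ⟨fun k => ((L (e k)).toReal : ℂ), fun k => a (e k), ?_, fun k => hatom _, ?_, ?_⟩
  · simp only [hnorm]
    exact (e.summable_iff (f := fun i => (L i).toReal)).2 (ENNReal.summable_toReal hLfin)
  · filter_upwards [hAcov] with p hp
    refine (e.hasSum_iff (f := fun i => ((L i).toReal : ℂ) * a i p)).2 ?_
    by_cases hfp : f p = 0
    · rw [hfp]
      convert hasSum_zero using 2 with i
      have : a i p = 0 := by
        simp only [hadef, indicator, hfp]; simp
      rw [this, mul_zero]
    · obtain ⟨i, hi⟩ := hp (by simp [hFdef, hfp, hq0])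
      have hterm : ((L i).toReal : ℂ) * a i p = f p := by
        simp only [hadef, indicator_of_mem hi]
        have hpos := ENNReal.toReal_pos (hL0 i (hAS i p hi)) (hLt i)
        rw [mul_inv_cancel_left₀]
        exact_mod_cast hpos.ne'
      rw [← hterm]
      refine hasSum_single i fun j hj => ?_
      have : p ∉ A j := fun hpj => hj (hAdisj j i p hpj hi)
      simp only [hadef, indicator_of_notMem this, mul_zero]
  · simp only [hnorm]
    rw [e.tsum_eq (fun i => (L i).toReal), ← ENNReal.tsum_toReal_eq hLt, ENNReal.ofReal_toReal hLfin]
    exact hLsum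
end
end

section
/- Let 1 < q < ∞ and 1 < α₀ < α. There exists a constant C, depending only on α₀, α, q and the dimension n, such that for every measurable function f : D → ℂ one has ‖J_{α₀} f‖ ≤ ‖J_α f‖ ≤ C ‖J_{α₀} f‖, where ‖J_β f‖ := ∫_{ℝⁿ} ( ∬_D 1_{B(y, βt)}(x) · γ(B(y,t))^{−1} · |f(y,t)|^q dγ(y) dt/t )^{1/q} dγ(x) for β > 0. -/
open MeasureTheory Metric Set
open scoped ENNReal

noncomputable section

/-- `‖J_β f‖ = ∫_{ℝⁿ} (∬_D 1_{B(y,βt)}(x) γ(B(y,t))⁻¹ |f(y,t)|^q dγ(y) dt/t)^{1/q} dγ(x)`,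
the `T^{1,q}(γ)` norm with aperture `β`. -/
def Jnorm (n : ℕ) (q β : ℝ) (f : E n × ℝ → ℂ) : ℝ≥0∞ :=
  ∫⁻ x, (∫⁻ p, (ball p.1 (β * p.2)).indicator (fun _ => (gaussianM n (ball p.1 p.2))⁻¹) x *
      (‖f p‖₊ : ℝ≥0∞) ^ q ∂(DMeasure n)) ^ (1 / q) ∂(gaussianM n)

lemma gauss_finite (n : ℕ) : gaussianM n univ < ∞ := by
  rw [gaussianM, withDensity_apply _ MeasurableSet.univ, Measure.restrict_univ]
  have h : Integrable (fun x : E n => Real.exp (-‖x‖ ^ 2 / 2)) := by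
    have := GaussianFourier.integrable_cexp_neg_mul_sq_norm_add (V := E n) (b := 1/2)
      (by norm_num) 0 0
    have h2 := this.norm
    refine h2.congr (Filter.Eventually.of_forall fun x => ?_)
    simp only [Complex.norm_exp]
    congr 1
    simp [← Complex.ofReal_pow]
    ring
  exact (h.const_mul _).lintegral_lt_top

instance gauss_isFinite (n : ℕ) : IsFiniteMeasure (gaussianM n) := ⟨gauss_finite n⟩

lemma D_facts {n : ℕ} {p : E n × ℝ} (hp : p ∈ Dset n) :
    0 < p.2 ∧ p.2 < 1 ∧ p.2 * ‖p.1‖ ≤ 1 := by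
  obtain ⟨h0, h1⟩ := hp
  unfold mFun at h1
  split_ifs at h1 with h
  · exact ⟨h0, h1, by nlinarith [norm_nonneg p.1]⟩
  · push Not at h
    refine ⟨h0, h1.trans (inv_lt_one_of_one_lt₀ h), ?_⟩
    have : p.2 * ‖p.1‖ ≤ ‖p.1‖⁻¹ * ‖p.1‖ := by gcongr
    rwa [inv_mul_cancel₀ (by positivity)] at this

def wd {n : ℕ} (x : E n) : ℝ≥0∞ :=
  ENNReal.ofReal ((2 * Real.pi) ^ (-(n : ℝ) / 2) * Real.exp (-‖x‖ ^ 2 / 2))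

lemma wd_le {n : ℕ} (x y : E n) (K : ℝ) (h : ‖y‖ ^ 2 - ‖x‖ ^ 2 ≤ 2 * K) :
    wd x ≤ ENNReal.ofReal (Real.exp K) * wd y := by
  unfold wd
  rw [← ENNReal.ofReal_mul (Real.exp_pos _).le]
  apply ENNReal.ofReal_le_ofReal
  rw [mul_left_comm, ← Real.exp_add]
  gcongr
  linarith

lemma gauss_ball (n : ℕ) (y : E n) (r : ℝ) :
    gaussianM n (ball y r) = ∫⁻ x in ball y r, wd x := by
  rw [gaussianM, withDensity_apply _ measurableSet_ball]; rfl

lemma gauss_ball_le {n : ℕ} {β : ℝ} (hβ : 0 < β) {p : E n × ℝ} (hp : p ∈ Dset n) :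
    gaussianM n (ball p.1 (β * p.2)) ≤
      ENNReal.ofReal (Real.exp β) * wd p.1 * volume (ball p.1 (β * p.2)) := by
  obtain ⟨h0, h1, h2⟩ := D_facts hp
  rw [gauss_ball, ← setLIntegral_const]
  refine setLIntegral_mono' measurableSet_ball fun x hx => wd_le _ _ _ ?_
  have hx' : ‖p.1 - x‖ < β * p.2 := by rw [← dist_eq_norm, dist_comm]; exact hx
  have h3 : ‖p.1‖ - ‖x‖ ≤ β * p.2 := (norm_sub_norm_le _ _).trans hx'.le
  have hx0 := norm_nonneg x
  have hy0 := norm_nonneg p.1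
  by_cases h : ‖p.1‖ ≤ ‖x‖
  · nlinarith
  · push Not at h
    calc ‖p.1‖ ^ 2 - ‖x‖ ^ 2 = (‖p.1‖ - ‖x‖) * (‖p.1‖ + ‖x‖) := by ring
      _ ≤ (β * p.2) * (‖p.1‖ + ‖p.1‖) := by gcongr
      _ = 2 * (β * (p.2 * ‖p.1‖)) := by ring
      _ ≤ 2 * β := by nlinarith

lemma le_gauss_ball {n : ℕ} {p : E n × ℝ} (hp : p ∈ Dset n) :
    wd p.1 * volume (ball p.1 p.2) ≤
      ENNReal.ofReal (Real.exp (3/2)) * gaussianM n (ball p.1 p.2) := by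
  obtain ⟨h0, h1, h2⟩ := D_facts hp
  rw [gauss_ball, ← lintegral_const_mul' _ _ ENNReal.ofReal_ne_top, ← setLIntegral_const]
  refine setLIntegral_mono' measurableSet_ball fun x hx => wd_le _ _ _ ?_
  have hx' : ‖x - p.1‖ < p.2 := by rw [← dist_eq_norm]; exact hx
  have h3 : ‖x‖ - ‖p.1‖ ≤ p.2 := (norm_sub_norm_le _ _).trans hx'.le
  have hx0 := norm_nonneg x
  have hy0 := norm_nonneg p.1
  have : ‖x‖ ^ 2 ≤ (‖p.1‖ + p.2) ^ 2 := by gcongr; linarith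
  nlinarith

lemma gauss_ball_pos {n : ℕ} {p : E n × ℝ} (hp : p ∈ Dset n) {r : ℝ} (hr : p.2 ≤ r) :
    gaussianM n (ball p.1 r) ≠ 0 := by
  intro h
  have h' : gaussianM n (ball p.1 p.2) = 0 := measure_mono_null (ball_subset_ball hr) h
  have := le_gauss_ball hp
  rw [h', mul_zero, nonpos_iff_eq_zero, mul_eq_zero] at this
  rcases this with h | h
  · unfold wd at h
    rw [ENNReal.ofReal_eq_zero] at h
    have : 0 < (2 * Real.pi) ^ (-(n : ℝ) / 2) * Real.exp (-‖p.1‖ ^ 2 / 2) := by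
      have := Real.pi_pos
      positivity
    linarith
  · exact (measure_ball_pos volume p.1 (D_facts hp).1).ne' h

lemma gauss_doubling (n : ℕ) {β : ℝ} (hβ : 0 < β) :
    ∃ C : ℝ≥0∞, C ≠ ∞ ∧ ∀ p ∈ Dset n, ∀ r, p.2 ≤ r →
      gaussianM n (ball p.1 (β * p.2)) ≤ C * gaussianM n (ball p.1 r) := by
  refine ⟨ENNReal.ofReal (Real.exp β) * ENNReal.ofReal (β ^ n) * ENNReal.ofReal (Real.exp (3/2)),
    by finiteness, fun p hp r hr => ?_⟩
  refine (gauss_ball_le hβ hp).trans ?_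
  rw [Measure.addHaar_ball_mul_of_pos _ _ hβ, finrank_euclideanSpace_fin,
    ← Measure.addHaar_ball_center volume p.1 p.2]
  calc _ = ENNReal.ofReal (Real.exp β) * ENNReal.ofReal (β ^ n) *
        (wd p.1 * volume (ball p.1 p.2)) := by ring
    _ ≤ ENNReal.ofReal (Real.exp β) * ENNReal.ofReal (β ^ n) *
        (ENNReal.ofReal (Real.exp (3/2)) * gaussianM n (ball p.1 p.2)) := by
      exact mul_le_mul_right (le_gauss_ball hp) _
    _ ≤ ENNReal.ofReal (Real.exp β) * ENNReal.ofReal (β ^ n) *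
        (ENNReal.ofReal (Real.exp (3/2)) * gaussianM n (ball p.1 r)) := by
      gcongr
    _ = _ := by ring

lemma sq_layer (a : ℝ≥0∞) :
    a ^ 2 ≤ ∫⁻ t in Ioi (0:ℝ), ENNReal.ofReal (2 * t) *
      (if ENNReal.ofReal t < a then 1 else 0) := by
  have key : ∀ b : ℝ, 0 ≤ b → ENNReal.ofReal b ≤ a → ENNReal.ofReal b ^ 2 ≤
      ∫⁻ t in Ioi (0:ℝ), ENNReal.ofReal (2 * t) * (if ENNReal.ofReal t < a then 1 else 0) := by
    intro b hb hba
    have h1 : ENNReal.ofReal b ^ 2 = ∫⁻ t in Ioo 0 b, ENNReal.ofReal (2 * t) := by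
      rw [← ofReal_integral_eq_lintegral_ofReal]
      · rw [← integral_Ioc_eq_integral_Ioo, ← intervalIntegral.integral_of_le hb]
        rw [← ENNReal.ofReal_pow hb]
        rw [intervalIntegral.integral_const_mul, integral_id]
        congr 1
        ring
      · have : IntegrableOn (fun t : ℝ => 2 * t) (Icc 0 b) :=
          (by fun_prop : Continuous fun t : ℝ => 2 * t).integrableOn_Icc
        exact this.mono_set Ioo_subset_Icc_self
      · filter_upwards [ae_restrict_mem measurableSet_Ioo] with t ht
        have := ht.1
        simp only [Pi.zero_apply]; linarith
    rw [h1]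
    calc _ = ∫⁻ t in Ioo 0 b, ENNReal.ofReal (2 * t) * (if ENNReal.ofReal t < a then 1 else 0) := by
          refine setLIntegral_congr_fun measurableSet_Ioo fun t ht => ?_
          have : ENNReal.ofReal t < a :=
            lt_of_lt_of_le ((ENNReal.ofReal_lt_ofReal_iff (ht.1.trans ht.2)).2 ht.2) hba
          simp [this]
      _ ≤ _ := lintegral_mono_set Ioo_subset_Ioi_self
  by_cases ha : a = ∞
  · subst ha
    refine le_trans le_top (top_le_iff.2 ?_).ge
    refine ENNReal.eq_top_of_forall_nnreal_le fun r => ?_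
    have h1 : (1:ℝ) ≤ 1 + (r:ℝ) := by have := r.2; simp
    refine le_trans ?_ (key (1 + r) (by linarith) le_top)
    have : (r : ℝ≥0∞) = ENNReal.ofReal r := by simp
    rw [this, ← ENNReal.ofReal_pow (by linarith)]
    apply ENNReal.ofReal_le_ofReal
    nlinarith
  · have := key a.toReal ENNReal.toReal_nonneg (by rw [ENNReal.ofReal_toReal ha])
    rwa [ENNReal.ofReal_toReal ha] at this

lemma layer_upper (h : ℝ≥0∞) :
    ∫⁻ t in Ioi (0:ℝ), (if ENNReal.ofReal t < 2 * h then (1:ℝ≥0∞) else 0) ≤ 2 * h := by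
  by_cases hh : h = ∞
  · simp [hh]
  have : ∀ t : ℝ, (if ENNReal.ofReal t < 2 * h then (1:ℝ≥0∞) else 0)
      = {t | ENNReal.ofReal t < 2 * h}.indicator 1 t := by
    intro t; simp [indicator]
  simp_rw [this]
  rw [lintegral_indicator_one (measurableSet_lt (by fun_prop) (by fun_prop)),
    Measure.restrict_apply (measurableSet_lt (by fun_prop) (by fun_prop))]
  have hf : 2 * h ≠ ∞ := by finiteness
  calc _ ≤ volume (Ioo 0 (2 * h).toReal) := by
        apply measure_mono
        rintro t ⟨h1, h2⟩
        exact ⟨h2, (ENNReal.ofReal_lt_iff_lt_toReal (le_of_lt h2) hf).1 h1⟩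
    _ = 2 * h := by rw [Real.volume_Ioo, sub_zero, ENNReal.ofReal_toReal hf]

/-- Jensen -/
lemma jensen_neg {X : Type*} [MeasurableSpace X] (ν : Measure X) [IsFiniteMeasure ν]
    (h0 : ν univ ≠ 0) (h : X → ℝ≥0∞) (hm : Measurable h) {r : ℝ} (hr : 0 < r) :
    ν univ * ((∫⁻ x, h x ∂ν) / ν univ) ^ (-r) ≤ ∫⁻ x, h x ^ (-r) ∂ν := by
  have hT : ν univ ≠ ∞ := measure_ne_top _ _
  set a := ∫⁻ x, h x ∂ν with ha
  set b := ∫⁻ x, h x ^ (-r) ∂ν with hb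
  by_cases hbt : b = ∞
  · rw [hbt]; exact le_top
  by_cases hat : a = ∞
  · rw [hat, ENNReal.top_div_of_ne_top hT, ENNReal.top_rpow_of_neg (by linarith)]; simp
  have hae1 : ∀ᵐ x ∂ν, h x < ∞ := ae_lt_top hm hat
  have hae2 : ∀ᵐ x ∂ν, h x ^ (-r) < ∞ := ae_lt_top (by fun_prop) hbt
  have hr1 : 0 < r + 1 := by linarith
  have hpq : ((r+1)/r).HolderConjugate (r+1) := by
    refine ⟨?_, by positivity, hr1⟩
    field_simp
  have hold := ENNReal.lintegral_mul_le_Lp_mul_Lq ν hpq (f := fun x => h x ^ (r/(r+1)))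
    (g := fun x => h x ^ (-(r/(r+1)))) (by fun_prop) (by fun_prop)
  have e1 : ∫⁻ x, ((fun x => h x ^ (r/(r+1))) * (fun x => h x ^ (-(r/(r+1))))) x ∂ν = ν univ := by
    rw [← lintegral_one]
    apply lintegral_congr_ae
    filter_upwards [hae1, hae2] with x h1 h2
    have hx0 : h x ≠ 0 := by
      intro h3
      rw [h3, ENNReal.zero_rpow_of_neg (by linarith)] at h2
      exact lt_irrefl _ h2
    simp only [Pi.mul_apply]
    rw [← ENNReal.rpow_add _ _ hx0 h1.ne]
    simp
  have e2 : ∫⁻ x, (h x ^ (r/(r+1))) ^ ((r+1)/r) ∂ν = a := by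
    simp_rw [← ENNReal.rpow_mul]
    rw [show r/(r+1) * ((r+1)/r) = 1 by field_simp]
    simp [ha]
  have e3 : ∫⁻ x, (h x ^ (-(r/(r+1)))) ^ (r+1) ∂ν = b := by
    simp_rw [← ENNReal.rpow_mul]
    rw [show -(r/(r+1)) * (r+1) = -r by field_simp]
  rw [e1, e2, e3] at hold
  -- T ≤ a^(r/(r+1)) * b^(1/(r+1))
  have h2 := ENNReal.rpow_le_rpow hold hr1.le
  rw [ENNReal.mul_rpow_of_nonneg _ _ hr1.le, ← ENNReal.rpow_mul, ← ENNReal.rpow_mul,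
    show 1 / ((r+1)/r) * (r+1) = r by field_simp, show 1 / (r+1) * (r+1) = 1 by field_simp,
    ENNReal.rpow_one, ENNReal.rpow_add _ _ h0 hT, ENNReal.rpow_one] at h2
  have ha0 : a ≠ 0 := by
    intro h3
    rw [h3, ENNReal.zero_rpow_of_pos hr, zero_mul, nonpos_iff_eq_zero, mul_eq_zero] at h2
    rcases h2 with h2 | h2
    · rw [ENNReal.rpow_eq_zero_iff] at h2
      rcases h2 with h2 | h2
      · exact h0 h2.1
      · linarith [h2.2]
    · exact h0 h2
  have hara : a ^ r ≠ 0 := by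
    rw [Ne, ENNReal.rpow_eq_zero_iff]; push Not
    exact ⟨fun h => absurd h ha0, fun h => absurd h hat⟩
  rw [ENNReal.rpow_neg, ENNReal.div_rpow_of_nonneg _ _ hr.le, ENNReal.inv_div (by left; finiteness) (by
      right; exact hara), mul_div_assoc', mul_comm]
  exact ENNReal.div_le_of_le_mul' h2

/-- Average of `h` over `B(y, α₀ t)`. -/
def avg (n : ℕ) (α₀ : ℝ) (h : E n → ℝ≥0∞) (p : E n × ℝ) : ℝ≥0∞ :=
  (∫⁻ x in ball p.1 (α₀ * p.2), h x ∂(gaussianM n)) / gaussianM n (ball p.1 (α₀ * p.2))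

/-- Admissible maximal function. -/
def maxF (n : ℕ) (α₀ α : ℝ) (h : E n → ℝ≥0∞) (x : E n) : ℝ≥0∞ :=
  ⨆ p : E n × ℝ, ⨆ _ : p ∈ Dset n ∧ x ∈ ball p.1 (α * p.2), avg n α₀ h p

lemma maxF_set (n : ℕ) (α₀ α : ℝ) (h : E n → ℝ≥0∞) (l : ℝ≥0∞) :
    {x | l < maxF n α₀ α h x} =
      ⋃ p ∈ {p | p ∈ Dset n ∧ l < avg n α₀ h p}, ball p.1 (α * p.2) := by
  ext x
  simp only [maxF, mem_ofPred_eq, lt_iSup_iff, mem_iUnion]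
  constructor
  · rintro ⟨p, ⟨h1, h2⟩, h3⟩; exact ⟨p, ⟨h1, h3⟩, h2⟩
  · rintro ⟨p, ⟨h1, h3⟩, h2⟩; exact ⟨p, ⟨h1, h2⟩, h3⟩

lemma maxF_measurable (n : ℕ) (α₀ α : ℝ) (h : E n → ℝ≥0∞) : Measurable (maxF n α₀ α h) := by
  refine measurable_of_Ioi fun l => ?_
  have : maxF n α₀ α h ⁻¹' Ioi l = {x | l < maxF n α₀ α h x} := rfl
  rw [this, maxF_set]
  exact (isOpen_biUnion fun _ _ => isOpen_ball).measurableSet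

lemma le_maxF {n : ℕ} {α₀ α : ℝ} (h : E n → ℝ≥0∞) {p : E n × ℝ} (hp : p ∈ Dset n) {x : E n}
    (hx : x ∈ ball p.1 (α * p.2)) : avg n α₀ h p ≤ maxF n α₀ α h x :=
  le_iSup₂_of_le p ⟨hp, hx⟩ le_rfl

lemma avg_trunc {n : ℕ} {α₀ : ℝ} (hα₀ : 1 < α₀) {h : E n → ℝ≥0∞}
    {p : E n × ℝ} (hp : p ∈ Dset n) {l : ℝ} (hl : 0 < l) (hlt : ENNReal.ofReal l < avg n α₀ h p) :
    ENNReal.ofReal (l / 2) * gaussianM n (ball p.1 (α₀ * p.2)) ≤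
      ∫⁻ x in ball p.1 (α₀ * p.2),
        h x * (if ENNReal.ofReal l < 2 * h x then 1 else 0) ∂(gaussianM n) := by
  have hpos := (D_facts hp).1
  have hr : p.2 ≤ α₀ * p.2 := by nlinarith
  have h0 := gauss_ball_pos hp hr
  have hT : gaussianM n (ball p.1 (α₀ * p.2)) ≠ ∞ := measure_ne_top _ _
  set T := gaussianM n (ball p.1 (α₀ * p.2)) with hTd
  set X := ∫⁻ x in ball p.1 (α₀ * p.2),
        h x * (if ENNReal.ofReal l < 2 * h x then 1 else 0) ∂(gaussianM n) with hX
  have hl2 : ENNReal.ofReal l = ENNReal.ofReal (l/2) + ENNReal.ofReal (l/2) := by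
    rw [← ENNReal.ofReal_add (by linarith) (by linarith)]; congr 1; ring
  have h1 : ENNReal.ofReal l * T ≤ ∫⁻ x in ball p.1 (α₀ * p.2), h x ∂(gaussianM n) := by
    have := hlt.le
    unfold avg at this
    rwa [ENNReal.le_div_iff_mul_le (Or.inl h0) (Or.inl hT)] at this
  have h2 : ∫⁻ x in ball p.1 (α₀ * p.2), h x ∂(gaussianM n) ≤ X + ENNReal.ofReal (l/2) * T := by
    rw [hTd, ← setLIntegral_const, ← lintegral_add_right _ measurable_const]
    refine lintegral_mono fun x => ?_
    dsimp only
    split_ifs with hx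
    · simp
    · simp only [mul_zero, zero_add]
      push Not at hx
      have h3 : 2 * h x ≤ 2 * ENNReal.ofReal (l/2) := by rw [two_mul (ENNReal.ofReal _), ← hl2]; exact hx
      exact (ENNReal.mul_le_mul_iff_right (by simp) (by simp)).1 h3
  have h4 := h1.trans h2
  rw [hl2, add_mul] at h4
  exact (ENNReal.add_le_add_iff_right (by finiteness)).1 h4

lemma weak_type (n : ℕ) {α₀ α : ℝ} (hα₀ : 1 < α₀) (hα : α₀ < α) :
    ∃ C : ℝ≥0∞, C ≠ ∞ ∧ ∀ h : E n → ℝ≥0∞, ∀ l : ℝ, 0 < l →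
      ENNReal.ofReal (l / 2) * gaussianM n {x | ENNReal.ofReal l < maxF n α₀ α h x} ≤
      C * ∫⁻ x, h x * (if ENNReal.ofReal l < 2 * h x then 1 else 0) ∂(gaussianM n) := by
  obtain ⟨C, hC, hd⟩ := gauss_doubling n (β := 6 * α) (by linarith)
  refine ⟨C, hC, fun h l hl => ?_⟩
  set t : Set (E n × ℝ) := {p | p ∈ Dset n ∧ ENNReal.ofReal l < avg n α₀ h p} with ht
  obtain ⟨u, hut, hdisj, hcov⟩ := Vitali.exists_disjoint_subfamily_covering_enlargement_closedBall
    t (fun p => p.1) (fun p => α * p.2) α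
    (fun p hp => by have := (D_facts hp.1).2.1; nlinarith) 5 (by norm_num)
  have hucount : u.Countable := by
    refine hdisj.countable_of_nonempty_interior fun p hp => ?_
    have := (D_facts (hut hp).1).1
    exact ⟨p.1, ball_subset_interior_closedBall (mem_ball_self (by nlinarith))⟩
  have hsub : {x | ENNReal.ofReal l < maxF n α₀ α h x} ⊆ ⋃ p ∈ u, ball p.1 (6 * α * p.2) := by
    rw [maxF_set]
    refine iUnion₂_subset fun p hp => ?_
    obtain ⟨b, hb, hpb⟩ := hcov p hp
    refine (ball_subset_closedBall.trans hpb).trans (Subset.trans ?_ (subset_biUnion_of_mem hb))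
    have := (D_facts (hut hb).1).1
    exact closedBall_subset_ball (by nlinarith)
  have hdisj2 : u.PairwiseDisjoint fun p => ball p.1 (α₀ * p.2) := by
    intro a ha b hb hab
    have h1 := (D_facts (hut ha).1).1
    have h2 := (D_facts (hut hb).1).1
    exact (hdisj ha hb hab).mono
      (ball_subset_closedBall.trans (closedBall_subset_closedBall (by nlinarith)))
      (ball_subset_closedBall.trans (closedBall_subset_closedBall (by nlinarith)))
  calc _ ≤ ENNReal.ofReal (l / 2) * ∑' p : u, gaussianM n (ball p.1.1 (6 * α * p.1.2)) := by
        gcongr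
        exact (measure_mono hsub).trans (measure_biUnion_le _ hucount _)
    _ = ∑' p : u, ENNReal.ofReal (l / 2) * gaussianM n (ball p.1.1 (6 * α * p.1.2)) :=
        ENNReal.tsum_mul_left.symm
    _ ≤ ∑' p : u, C * ∫⁻ x in ball p.1.1 (α₀ * p.1.2),
        h x * (if ENNReal.ofReal l < 2 * h x then 1 else 0) ∂(gaussianM n) := by
        refine ENNReal.tsum_le_tsum fun p => ?_
        have hp := hut p.2
        have h1 := (D_facts hp.1).1
        calc _ ≤ ENNReal.ofReal (l / 2) * (C * gaussianM n (ball p.1.1 (α₀ * p.1.2))) := by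
              gcongr; exact hd _ hp.1 _ (by nlinarith)
          _ = C * (ENNReal.ofReal (l / 2) * gaussianM n (ball p.1.1 (α₀ * p.1.2))) := by ring
          _ ≤ _ := by gcongr; exact avg_trunc hα₀ hp.1 hl hp.2
    _ = C * ∫⁻ x in ⋃ p ∈ u, ball p.1 (α₀ * p.2),
        h x * (if ENNReal.ofReal l < 2 * h x then 1 else 0) ∂(gaussianM n) := by
        rw [ENNReal.tsum_mul_left, lintegral_biUnion hucount (fun _ _ => measurableSet_ball) hdisj2]
    _ ≤ _ := mul_le_mul_right (setLIntegral_le_lintegral _ _) _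

lemma strong_type (n : ℕ) {α₀ α : ℝ} (hα₀ : 1 < α₀) (hα : α₀ < α) :
    ∃ C : ℝ≥0∞, C ≠ ∞ ∧ ∀ h : E n → ℝ≥0∞, Measurable h →
      ∫⁻ x, maxF n α₀ α h x ^ 2 ∂(gaussianM n) ≤ C * ∫⁻ x, h x ^ 2 ∂(gaussianM n) := by
  obtain ⟨C, hC, hw⟩ := weak_type n hα₀ hα
  refine ⟨8 * C, by finiteness, fun h hm => ?_⟩
  have hM := maxF_measurable n α₀ α h
  calc _ ≤ ∫⁻ x, (∫⁻ t in Ioi (0:ℝ), ENNReal.ofReal (2 * t) *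
      (if ENNReal.ofReal t < maxF n α₀ α h x then 1 else 0)) ∂(gaussianM n) :=
        lintegral_mono fun x => sq_layer _
    _ = ∫⁻ t in Ioi (0:ℝ), ∫⁻ x, ENNReal.ofReal (2 * t) *
      (if ENNReal.ofReal t < maxF n α₀ α h x then 1 else 0) ∂(gaussianM n) := by
        refine lintegral_lintegral_swap (Measurable.aemeasurable ?_)
        refine Measurable.mul (by fun_prop) (Measurable.ite ?_ measurable_const measurable_const)
        exact measurableSet_lt (by fun_prop) (by fun_prop)
    _ ≤ ∫⁻ t in Ioi (0:ℝ), ∫⁻ x, 4 * C * (h x *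
        (if ENNReal.ofReal t < 2 * h x then 1 else 0)) ∂(gaussianM n) := by
        refine setLIntegral_mono' measurableSet_Ioi fun t ht => ?_
        rw [lintegral_const_mul' _ _ ENNReal.ofReal_ne_top, lintegral_const_mul' _ _ (by finiteness)]
        have e : ∫⁻ x, (if ENNReal.ofReal t < maxF n α₀ α h x then 1 else 0) ∂(gaussianM n)
            = gaussianM n {x | ENNReal.ofReal t < maxF n α₀ α h x} := by
          rw [← lintegral_indicator_one (measurableSet_lt (by fun_prop) (by fun_prop))]
          simp [indicator]
        rw [e, show 2 * t = 4 * (t / 2) by ring, ENNReal.ofReal_mul (by norm_num), mul_assoc,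
          mul_assoc]
        have := hw h t ht
        simp only [ENNReal.ofReal_ofNat]
        gcongr
    _ = ∫⁻ x, (∫⁻ t in Ioi (0:ℝ), 4 * C * (h x *
        (if ENNReal.ofReal t < 2 * h x then 1 else 0))) ∂(gaussianM n) := by
        refine lintegral_lintegral_swap (Measurable.aemeasurable ?_)
        refine Measurable.const_mul (Measurable.mul (by fun_prop)
          (Measurable.ite ?_ measurable_const measurable_const)) _
        exact measurableSet_lt (by fun_prop) (by fun_prop)
    _ ≤ ∫⁻ x, 8 * C * h x ^ 2 ∂(gaussianM n) := by
        refine lintegral_mono fun x => ?_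
        dsimp only
        have hms : Measurable fun t : ℝ => (if ENNReal.ofReal t < 2 * h x then (1:ℝ≥0∞) else 0) :=
          Measurable.ite (measurableSet_lt (by fun_prop) (by fun_prop)) measurable_const
            measurable_const
        rw [lintegral_const_mul' _ _ (by finiteness), lintegral_const_mul _ hms]
        calc _ ≤ 4 * C * (h x * (2 * h x)) := by gcongr; exact layer_upper _
          _ = _ := by ring
    _ = _ := lintegral_const_mul' _ _ (by finiteness)

/-- The inner area integral. -/
def Aint (n : ℕ) (β : ℝ) (F : E n × ℝ → ℝ≥0∞) (x : E n) : ℝ≥0∞ :=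
  ∫⁻ p, (if dist x p.1 < β * p.2 then 1 else 0) * F p ∂(DMeasure n)

instance DM_sfinite (n : ℕ) : SFinite (DMeasure n) := by
  unfold DMeasure tMeasure; infer_instance

lemma kernel_meas (n : ℕ) (β : ℝ) :
    Measurable (fun z : E n × (E n × ℝ) =>
      (if dist z.1 z.2.1 < β * z.2.2 then (1:ℝ≥0∞) else 0)) :=
  Measurable.ite (measurableSet_lt (by fun_prop) (by fun_prop)) measurable_const measurable_const

lemma Aint_measurable (n : ℕ) (β : ℝ) {F : E n × ℝ → ℝ≥0∞} (hF : Measurable F) :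
    Measurable (Aint n β F) := by
  unfold Aint
  exact Measurable.lintegral_prod_right' (f := fun z : E n × (E n × ℝ) =>
      (if dist z.1 z.2.1 < β * z.2.2 then (1:ℝ≥0∞) else 0) * F z.2)
    ((kernel_meas n β).mul (by fun_prop))

lemma Aint_pair (n : ℕ) (β : ℝ) {F : E n × ℝ → ℝ≥0∞} (hF : Measurable F)
    {g : E n → ℝ≥0∞} (hg : Measurable g) :
    ∫⁻ x, Aint n β F x * g x ∂(gaussianM n) =
      ∫⁻ p, F p * ∫⁻ x in ball p.1 (β * p.2), g x ∂(gaussianM n) ∂(DMeasure n) := by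
  have hk := kernel_meas n β
  have hkx : ∀ x : E n, Measurable fun p : E n × ℝ =>
      (if dist x p.1 < β * p.2 then (1:ℝ≥0∞) else 0) := fun x =>
    Measurable.ite (measurableSet_lt (by fun_prop) (by fun_prop)) measurable_const measurable_const
  have hkp : ∀ p : E n × ℝ, Measurable fun x : E n =>
      (if dist x p.1 < β * p.2 then (1:ℝ≥0∞) else 0) := fun x =>
    Measurable.ite (measurableSet_lt (by fun_prop) (by fun_prop)) measurable_const measurable_const
  calc _ = ∫⁻ x, ∫⁻ p, (if dist x p.1 < β * p.2 then 1 else 0) * F p * g x ∂(DMeasure n)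
        ∂(gaussianM n) := by
        refine lintegral_congr fun x => ?_
        exact (lintegral_mul_const _ ((hkx x).mul hF)).symm
    _ = ∫⁻ p, ∫⁻ x, (if dist x p.1 < β * p.2 then 1 else 0) * F p * g x ∂(gaussianM n)
        ∂(DMeasure n) := by
        refine lintegral_lintegral_swap (Measurable.aemeasurable ?_)
        exact (hk.mul (by fun_prop)).mul (by fun_prop)
    _ = _ := by
        refine lintegral_congr fun p => ?_
        rw [← lintegral_indicator measurableSet_ball, ← lintegral_const_mul _
          (hg.indicator measurableSet_ball)]
        refine lintegral_congr fun x => ?_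
        by_cases hx : dist x p.1 < β * p.2
        · simp [hx, indicator]
        · simp [hx, indicator]

lemma rpow_anti {a b : ℝ≥0∞} (h : a ≤ b) {s : ℝ} (hs : 0 ≤ s) : b ^ (-s) ≤ a ^ (-s) := by
  rw [ENNReal.rpow_neg, ENNReal.rpow_neg]
  exact ENNReal.inv_le_inv.2 (ENNReal.rpow_le_rpow h hs)

lemma local_est {n : ℕ} {α₀ α : ℝ} (hα₀ : 1 < α₀) {C : ℝ≥0∞}
    (hd : ∀ p ∈ Dset n, ∀ r, p.2 ≤ r →
      gaussianM n (ball p.1 (α * p.2)) ≤ C * gaussianM n (ball p.1 r))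
    {h : E n → ℝ≥0∞} (hm : Measurable h) {r : ℝ} (hr : 0 < r) {p : E n × ℝ} (hp : p ∈ Dset n)
    {g : E n → ℝ≥0∞} (hg : ∀ x, maxF n α₀ α h x ≤ g x) :
    ∫⁻ x in ball p.1 (α * p.2), g x ^ (-r) ∂(gaussianM n) ≤
      C * ∫⁻ x in ball p.1 (α₀ * p.2), h x ^ (-r) ∂(gaussianM n) := by
  have hpos := (D_facts hp).1
  have hle : p.2 ≤ α₀ * p.2 := by nlinarith
  have h0 := gauss_ball_pos hp hle
  calc _ ≤ ∫⁻ x in ball p.1 (α * p.2), avg n α₀ h p ^ (-r) ∂(gaussianM n) :=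
        setLIntegral_mono' measurableSet_ball fun x hx =>
          rpow_anti ((le_maxF h hp hx).trans (hg x)) hr.le
    _ = avg n α₀ h p ^ (-r) * gaussianM n (ball p.1 (α * p.2)) := setLIntegral_const _ _
    _ ≤ avg n α₀ h p ^ (-r) * (C * gaussianM n (ball p.1 (α₀ * p.2))) := by
        gcongr; exact hd p hp _ hle
    _ = C * (gaussianM n (ball p.1 (α₀ * p.2)) * avg n α₀ h p ^ (-r)) := by ring
    _ ≤ _ := by
        gcongr
        have := jensen_neg ((gaussianM n).restrict (ball p.1 (α₀ * p.2))) (by simpa using h0) h hm hr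
        simpa [avg] using this

lemma eps_est {n : ℕ} {q α₀ α : ℝ} (hq : 1 < q) (hα₀ : 1 < α₀) (hα : α₀ < α) :
    ∃ C1 C2 : ℝ≥0∞, C1 ≠ ∞ ∧ C2 ≠ ∞ ∧ ∀ F : E n × ℝ → ℝ≥0∞, Measurable F → ∀ ε : ℝ≥0∞,
      ε ≠ 0 → ε ≠ ∞ → ∫⁻ x, Aint n α₀ F x ^ (1/q) ∂(gaussianM n) ≠ ∞ →
      ∫⁻ x, Aint n α F x ^ (1/q) ∂(gaussianM n) ≤
        (C1 * ∫⁻ x, Aint n α₀ F x ^ (1/q) ∂(gaussianM n)) ^ (1/q) *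
        (C2 * (∫⁻ x, Aint n α₀ F x ^ (1/q) ∂(gaussianM n) + ε)) ^ (1 - 1/q) := by
  obtain ⟨C, hC, hd⟩ := gauss_doubling n (β := α) (by linarith)
  obtain ⟨K, hK, hs⟩ := strong_type n hα₀ hα
  have hq0 : 0 < q := by linarith
  refine ⟨C, 2 * K + 2 * gaussianM n univ, hC, by finiteness, fun F hF ε hε hεt hI => ?_⟩
  set S : E n → ℝ≥0∞ := fun x => Aint n α₀ F x ^ (1/q) with hS
  set I := ∫⁻ x, S x ∂(gaussianM n) with hId
  have hSm : Measurable S := (Aint_measurable n α₀ hF).pow_const _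
  set h : E n → ℝ≥0∞ := fun x => S x ^ (1/2 : ℝ) with hh
  have hhm : Measurable h := hSm.pow_const _
  set g : E n → ℝ≥0∞ := fun x => maxF n α₀ α h x + ε ^ (1/2:ℝ) with hg
  have hMm := maxF_measurable n α₀ α h
  have hgm : Measurable g := hMm.add_const _
  have hh2 : ∀ x, h x ^ 2 = S x := fun x => by
    simp only [hh]; rw [← ENNReal.rpow_natCast, ← ENNReal.rpow_mul]; norm_num
  have he2 : (ε ^ (1/2:ℝ)) ^ 2 = ε := by
    rw [← ENNReal.rpow_natCast, ← ENNReal.rpow_mul]; norm_num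
  have hstr : ∫⁻ x, maxF n α₀ α h x ^ 2 ∂(gaussianM n) ≤ K * I := by
    have := hs h hhm
    simpa only [hh2] using this
  have hg2 : ∫⁻ x, g x ^ 2 ∂(gaussianM n) ≤ (2 * K + 2 * gaussianM n univ) * (I + ε) := by
    calc _ ≤ ∫⁻ x, (2 * maxF n α₀ α h x ^ 2 + 2 * ε) ∂(gaussianM n) := by
          refine lintegral_mono fun x => ?_
          have := ENNReal.rpow_add_le_mul_rpow_add_rpow (maxF n α₀ α h x) (ε ^ (1/2:ℝ))
            (p := 2) (by norm_num)
          simp only [hg]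
          norm_num at this
          rw [← mul_add]
          convert this using 3
          simpa using he2.symm
      _ = 2 * ∫⁻ x, maxF n α₀ α h x ^ 2 ∂(gaussianM n) + 2 * ε * gaussianM n univ := by
          rw [lintegral_add_right _ measurable_const, lintegral_const_mul' _ _ (by finiteness),
            lintegral_const]
      _ ≤ 2 * (K * I) + 2 * ε * gaussianM n univ := by gcongr
      _ ≤ 2 * (K * I) + 2 * ε * gaussianM n univ + (2 * K * ε + 2 * gaussianM n univ * I) :=
          le_self_add
      _ = _ := by ring
  have hg2t : ∫⁻ x, g x ^ 2 ∂(gaussianM n) ≠ ∞ := ne_top_of_le_ne_top (by finiteness) hg2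
  have hgae : ∀ᵐ x ∂(gaussianM n), g x ^ 2 < ∞ := ae_lt_top (by fun_prop) hg2t
  have hg0 : ∀ x, g x ≠ 0 := fun x => by
    have : ε ^ (1/2:ℝ) ≠ 0 := by
      intro h0; rw [h0] at he2; exact hε (by simpa using he2.symm)
    simp only [hg]; intro h0; exact this (add_eq_zero.1 h0).2
  set r := 2 * (q - 1) with hr
  have hr0 : 0 < r := by linarith
  have hmain : ∫⁻ x, Aint n α F x * g x ^ (-r) ∂(gaussianM n) ≤ C * I := by
    rw [Aint_pair n α hF (hgm.pow_const _)]
    calc _ ≤ ∫⁻ p, C * (F p * ∫⁻ x in ball p.1 (α₀ * p.2), h x ^ (-r) ∂(gaussianM n))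
            ∂(DMeasure n) := by
          unfold DMeasure
          refine setLIntegral_mono_ae' ?_ (Filter.Eventually.of_forall fun p hp => ?_)
          · unfold Dset
            refine (measurableSet_lt measurable_const measurable_snd).inter
              (measurableSet_lt measurable_snd ?_)
            unfold mFun
            exact Measurable.ite (measurableSet_le (by fun_prop) (by fun_prop)) (by fun_prop)
              (by fun_prop)
          · rw [mul_left_comm]
            gcongr
            exact local_est hα₀ hd hhm hr0 hp fun x => le_self_add
      _ = C * ∫⁻ x, Aint n α₀ F x * h x ^ (-r) ∂(gaussianM n) := by
          rw [lintegral_const_mul' _ _ hC, Aint_pair n α₀ hF (hhm.pow_const _)]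
      _ ≤ C * I := by
          refine mul_le_mul_right (lintegral_mono fun x => ?_) _
          simp only [hh]
          rw [← ENNReal.rpow_mul, show 1/2 * -r = 1 - q by rw [hr]; ring]
          have hAS : Aint n α₀ F x = S x ^ q := by
            simp only [hS]; rw [← ENNReal.rpow_mul]; field_simp; simp
          rw [hAS]
          by_cases h1 : S x = 0
          · rw [h1, ENNReal.zero_rpow_of_pos hq0]; simp
          by_cases h2 : S x = ∞
          · rw [h2]; exact le_top
          rw [← ENNReal.rpow_add _ _ h1 h2]; simp
  have hpq : q.HolderConjugate (q / (q - 1)) := Real.HolderConjugate.conjExponent hq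
  have hold := ENNReal.lintegral_mul_le_Lp_mul_Lq (gaussianM n) hpq
    (f := fun x => (Aint n α F x * g x ^ (-r)) ^ (1/q)) (g := fun x => (g x ^ 2) ^ (1 - 1/q))
    ((((Aint_measurable n α hF).mul (hgm.pow_const _)).pow_const _).aemeasurable)
    (by fun_prop)
  have hq1 : q - 1 ≠ 0 := by linarith
  have e1 : ∀ x, ((Aint n α F x * g x ^ (-r)) ^ (1/q)) ^ q = Aint n α F x * g x ^ (-r) :=
    fun x => by rw [← ENNReal.rpow_mul, one_div_mul_cancel hq0.ne', ENNReal.rpow_one]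
  have e2 : ∀ x, ((g x ^ 2) ^ (1 - 1/q)) ^ (q / (q - 1)) = g x ^ 2 :=
    fun x => by
      rw [← ENNReal.rpow_mul, show (1 - 1/q) * (q / (q-1)) = 1 by field_simp, ENNReal.rpow_one]
  simp only [e1, e2] at hold
  rw [show 1 / (q / (q - 1)) = 1 - 1/q by field_simp] at hold
  have h1q : 0 ≤ 1 - 1/q := by
    rw [sub_nonneg, div_le_one hq0]; exact hq.le
  calc _ = ∫⁻ x, ((fun x => (Aint n α F x * g x ^ (-r)) ^ (1/q)) *
        (fun x => (g x ^ 2) ^ (1 - 1/q))) x ∂(gaussianM n) := by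
        apply lintegral_congr_ae
        filter_upwards [hgae] with x hx
        have hgt : g x ≠ ∞ := by
          intro h0; rw [h0] at hx; simp at hx
        simp only [Pi.mul_apply]
        rw [ENNReal.mul_rpow_of_nonneg _ _ (by positivity), mul_assoc, ← ENNReal.rpow_natCast,
          ← ENNReal.rpow_mul, ← ENNReal.rpow_mul, ← ENNReal.rpow_add _ _ (hg0 x) hgt]
        have : -r * (1/q) + ((2:ℕ):ℝ) * (1 - 1/q) = 0 := by
          rw [hr]; push_cast; field_simp; ring
        rw [this]; simp
    _ ≤ _ := hold
    _ ≤ _ := by gcongr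

lemma J_eq (n : ℕ) (q β : ℝ) (f : E n × ℝ → ℂ) :
    Jnorm n q β f = ∫⁻ x, Aint n β
      (fun p => (gaussianM n (ball p.1 p.2))⁻¹ * (‖f p‖₊ : ℝ≥0∞) ^ q) x ^ (1/q)
      ∂(gaussianM n) := by
  unfold Jnorm Aint
  refine lintegral_congr fun x => ?_
  congr 1
  refine lintegral_congr fun p => ?_
  by_cases hx : dist x p.1 < β * p.2
  · simp [hx, indicator]
  · simp [hx, indicator]

lemma F_meas (n : ℕ) (q : ℝ) {f : E n × ℝ → ℂ} (hf : Measurable f) :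
    Measurable (fun p : E n × ℝ => (gaussianM n (ball p.1 p.2))⁻¹ * (‖f p‖₊ : ℝ≥0∞) ^ q) := by
  refine Measurable.mul (Measurable.inv ?_) (by fun_prop)
  have hs : MeasurableSet {z : (E n × ℝ) × E n | dist z.2 z.1.1 < z.1.2} :=
    measurableSet_lt (by fun_prop) (by fun_prop)
  exact measurable_measure_prodMk_left hs

/-- Change of aperture: for `1 < α₀ < α` there is a constant `C`, depending only on `α₀`,
`α`, `q` and `n`, with `‖J_{α₀} f‖ ≤ ‖J_α f‖ ≤ C ‖J_{α₀} f‖` for all measurable `f`. -/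
theorem stmt16 (n : ℕ) (hn : 1 ≤ n) (q : ℝ) (hq : 1 < q)
    (α₀ α : ℝ) (hα₀ : 1 < α₀) (hα : α₀ < α) :
    ∃ C : ℝ, 0 < C ∧
      ∀ f : E n × ℝ → ℂ, Measurable f →
        Jnorm n q α₀ f ≤ Jnorm n q α f ∧
        Jnorm n q α f ≤ ENNReal.ofReal C * Jnorm n q α₀ f := by
  obtain ⟨C1, C2, hC1, hC2, hmain⟩ := eps_est (n := n) hq hα₀ hα
  have hq0 : 0 < q := by linarith
  have h1q : 0 ≤ 1 - 1/q := by
    rw [sub_nonneg, div_le_one hq0]; exact hq.le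
  set K : ℝ≥0∞ := C1 ^ (1/q) * (C2 * 2) ^ (1 - 1/q) with hK
  have hKt : K ≠ ∞ := by
    refine ENNReal.mul_ne_top (ENNReal.rpow_ne_top_of_nonneg (by positivity) hC1)
      (ENNReal.rpow_ne_top_of_nonneg h1q (by finiteness))
  refine ⟨K.toReal + 1, by positivity, fun f hf => ⟨?_, ?_⟩⟩
  · rw [J_eq, J_eq]
    refine lintegral_mono fun x => ENNReal.rpow_le_rpow ?_ (by positivity)
    refine lintegral_mono fun p => ?_
    dsimp only
    gcongr
    by_cases hx : dist x p.1 < α₀ * p.2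
    · have h0 : 0 < α₀ * p.2 := dist_nonneg.trans_lt hx
      have h2 : 0 < p.2 := pos_of_mul_pos_right h0 (by linarith)
      have : dist x p.1 < α * p.2 := hx.trans_le (by gcongr)
      simp [this, hx]
    · simp [hx]
  · rw [J_eq, J_eq]
    have hF := F_meas n q hf
    set F : E n × ℝ → ℝ≥0∞ :=
      fun p => (gaussianM n (ball p.1 p.2))⁻¹ * (‖f p‖₊ : ℝ≥0∞) ^ q with hFd
    have hm := hmain F hF
    set I := ∫⁻ x, Aint n α₀ F x ^ (1/q) ∂(gaussianM n) with hI
    have hKle : K ≤ ENNReal.ofReal (K.toReal + 1) := by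
      rw [← ENNReal.ofReal_toReal hKt]
      exact ENNReal.ofReal_le_ofReal (by simp)
    by_cases hIt : I = ∞
    · rw [hIt, ENNReal.mul_top (by
        simp only [ne_eq, ENNReal.ofReal_eq_zero, not_le]; positivity)]
      exact le_top
    by_cases hI0 : I = 0
    · have := hm 1 one_ne_zero ENNReal.one_ne_top hIt
      rw [hI0, mul_zero, ENNReal.zero_rpow_of_pos (by positivity), zero_mul] at this
      exact this.trans zero_le
    · have := hm I hI0 hIt hIt
      refine this.trans (le_trans (le_of_eq ?_) (mul_le_mul_left hKle I))
      rw [← two_mul, ← mul_assoc, ENNReal.mul_rpow_of_nonneg _ _ (by positivity),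
        ENNReal.mul_rpow_of_nonneg _ _ h1q, hK, mul_mul_mul_comm, ← ENNReal.rpow_add _ _ hI0 hIt]
      simp
end
end
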